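/- arXiv:1902.05133 — 2 statements merged into one kernel-verified Lean document; each statement's English description precedes it below -/
import Mathlib

section
/- Let X ⊂ P³(K) be a smooth surface of degree d ≥ 3 over an algebraically closed field K of characteristic 0 or of characteristic p > d. For every point P ∈ X, the set of lines L ⊆ P³(K) with P ∈ L and i(P, L.X) ≥ 3 is either infinite or has cardinality exactly 1 or 2. -/
open MvPolynomial

/-- The restriction of the polynomial `g` to the line through `[u]` spanned by `u` and `v`,
under the linear parametrization `t ↦ u + t • v`. -/
noncomputable def restrictLine {K : Type*} [CommSemiring K] {n : ℕ}
    (g : MvPolynomial (Fin n) K) (u v : Fin n → K) : Polynomial K :=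
  MvPolynomial.aeval (fun i => Polynomial.C (u i) + Polynomial.X * Polynomial.C (v i)) g

/-- `ordGE g u v k` means: the order of vanishing at the point `P = [u]` of the restriction
of `g` to the line spanned by `u` and `v` is at least `k` (this includes the case of the
identically vanishing restriction, i.e. order `∞`). -/
def ordGE {K : Type*} [CommSemiring K] {n : ℕ}
    (g : MvPolynomial (Fin n) K) (u v : Fin n → K) (k : ℕ) : Prop :=
  ∀ j < k, (restrictLine g u v).coeff j = 0

/-- `f` defines a smooth surface of degree `d` in `ℙ³(K)`: `f` is homogeneous of degree `d`
and its four partial derivatives have no common zero in `ℙ³(K)`. -/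
def IsSmoothSurfaceOfDegree {K : Type*} [CommSemiring K]
    (f : MvPolynomial (Fin 4) K) (d : ℕ) : Prop :=
  f.IsHomogeneous d ∧
    ∀ w : Fin 4 → K, w ≠ 0 → ∃ i : Fin 4, MvPolynomial.eval w (MvPolynomial.pderiv i f) ≠ 0

/-- A line in `ℙ³(K)` (the projectivization of a 2-dimensional linear subspace `W` of `K⁴`)
that is contained in the surface `{f = 0}`. -/
def IsLineInSurface {K : Type*} [Field K]
    (f : MvPolynomial (Fin 4) K) (W : Submodule K (Fin 4 → K)) : Prop :=
  Module.finrank K W = 2 ∧ ∀ v ∈ W, MvPolynomial.eval v f = 0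

section RestrictLine

variable {K : Type*} [CommSemiring K] {n : ℕ}

theorem restrictLine_coeff_zero (g : MvPolynomial (Fin n) K) (u v : Fin n → K) :
    (restrictLine g u v).coeff 0 = eval u g := by
  induction g using MvPolynomial.induction_on with
  | C a => simp [restrictLine]
  | add p q hp hq => simp_all [restrictLine]
  | mul_X p i hp => simp_all [restrictLine, Polynomial.mul_coeff_zero]

theorem derivative_restrictLine (g : MvPolynomial (Fin n) K) (u v : Fin n → K) :
    Polynomial.derivative (restrictLine g u v) =
      ∑ i, Polynomial.C (v i) * restrictLine (pderiv i g) u v := by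
  induction g using MvPolynomial.induction_on with
  | C a => simp [restrictLine]
  | add p q hp hq =>
    simp_all [restrictLine, mul_add, Finset.sum_add_distrib]
  | mul_X p i hp =>
    have hmul (j : Fin n) : restrictLine (pderiv j (p * X i)) u v =
        restrictLine p u v * (if i = j then 1 else 0) +
          (Polynomial.C (u i) + Polynomial.X * Polynomial.C (v i)) *
            restrictLine (pderiv j p) u v := by
      simp only [restrictLine, Derivation.leibniz, pderiv_X, Pi.single_apply, smul_eq_mul,
        map_add, map_mul, aeval_X, apply_ite, map_one, map_zero]
    have hX : restrictLine (p * X i) u v =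
        restrictLine p u v * (Polynomial.C (u i) + Polynomial.X * Polynomial.C (v i)) := by
      simp [restrictLine]
    rw [hX, Polynomial.derivative_mul, hp]
    simp only [hmul, mul_add, Finset.sum_add_distrib, mul_ite, mul_one, mul_zero,
      Finset.sum_ite_eq, Finset.mem_univ, if_true, mul_left_comm (Polynomial.C (v _)),
      ← Finset.mul_sum, Polynomial.derivative_add, Polynomial.derivative_mul,
      Polynomial.derivative_C, Polynomial.derivative_X]
    ring

theorem restrictLine_coeff_one (g : MvPolynomial (Fin n) K) (u v : Fin n → K) :
    (restrictLine g u v).coeff 1 = ∑ i, v i * eval u (pderiv i g) := by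
  have h := congrArg (fun p => Polynomial.coeff p 0) (derivative_restrictLine g u v)
  simpa [Polynomial.coeff_derivative, Polynomial.finsetSum_coeff, restrictLine_coeff_zero] using h

theorem restrictLine_coeff_two_mul_two (g : MvPolynomial (Fin n) K) (u v : Fin n → K) :
    (restrictLine g u v).coeff 2 * 2 =
      ∑ i, v i * ∑ j, v j * eval u (pderiv j (pderiv i g)) := by
  have h := congrArg (fun p => Polynomial.coeff p 1) (derivative_restrictLine g u v)
  simp only [Polynomial.coeff_derivative, Polynomial.finsetSum_coeff, Polynomial.coeff_C_mul,
    restrictLine_coeff_one] at h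
  rw [← h]
  norm_num

theorem ordGE_three_iff {K : Type*} [Field K] (h2 : (2 : K) ≠ 0)
    (g : MvPolynomial (Fin n) K) (u v : Fin n → K) :
    ordGE g u v 3 ↔ eval u g = 0 ∧ ∑ i, v i * eval u (pderiv i g) = 0 ∧
      ∑ i, v i * ∑ j, v j * eval u (pderiv j (pderiv i g)) = 0 := by
  rw [← restrictLine_coeff_zero g u v, ← restrictLine_coeff_one, ← restrictLine_coeff_two_mul_two]
  simp only [mul_eq_zero, h2, or_false]
  refine ⟨fun h => ⟨h 0 (by simp), h 1 (by simp), h 2 (by simp)⟩, fun ⟨h0, h1, h2⟩ j hj => ?_⟩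
  interval_cases j <;> assumption

theorem MvPolynomial.pderiv_pderiv_comm (i j : Fin n) (g : MvPolynomial (Fin n) K) :
    pderiv i (pderiv j g) = pderiv j (pderiv i g) := by
  classical
  induction g using MvPolynomial.induction_on with
  | C a => simp
  | add p q hp hq => simp only [map_add, hp, hq]
  | mul_X p k hp =>
    have h (l m : Fin n) : pderiv l ((Pi.single m 1 : Fin n → MvPolynomial (Fin n) K) k) = 0 := by
      rw [Pi.single_apply]
      split_ifs <;> simp
    simp only [Derivation.leibniz, map_add, smul_eq_mul, pderiv_X, hp]
    rw [h, h]
    ring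

/-- Euler's identity, evaluated at a point. -/
theorem MvPolynomial.IsHomogeneous.sum_mul_eval_pderiv {g : MvPolynomial (Fin n) K} {d : ℕ}
    (hg : g.IsHomogeneous d) (u : Fin n → K) :
    ∑ i, u i * eval u (pderiv i g) = d * eval u g := by
  simpa using congrArg (eval u) hg.sum_X_mul_pderiv

end RestrictLine

section IsotropicPlanes

variable {K V : Type*} [Field K] [AddCommGroup V] [Module K V]

theorem Submodule.exists_mem_notMem_span [FiniteDimensional K V] (T : Submodule K V)
    (s : Finset V) (hs : s.card < Module.finrank K T) :
    ∃ v ∈ T, v ∉ Submodule.span K (s : Set V) := by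
  by_contra! h
  have h1 : Module.finrank K T ≤ Module.finrank K (Submodule.span K (s : Set V)) :=
    Submodule.finrank_mono h
  have h2 : Module.finrank K (Submodule.span K (s : Set V)) ≤ s.card :=
    finrank_span_finset_le_card s
  omega

theorem linearIndependent_pair_of_notMem_span {u w : V} (hu : u ≠ 0)
    (hw : w ∉ Submodule.span K {u}) : LinearIndependent K ![u, w] := by
  rw [LinearIndependent.pair_iff' hu]
  rintro a rfl
  exact hw (Submodule.smul_mem _ _ (Submodule.mem_span_singleton_self u))

theorem finrank_span_pair_of_notMem_span {u w : V} (hu : u ≠ 0)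
    (hw : w ∉ Submodule.span K {u}) : Module.finrank K (Submodule.span K {u, w}) = 2 := by
  have h := finrank_span_eq_card (linearIndependent_pair_of_notMem_span hu hw)
  rwa [Matrix.range_cons_cons_empty, Fintype.card_fin] at h

theorem Submodule.eq_span_pair [FiniteDimensional K V] {W : Submodule K V} {u w : V} (hu : u ≠ 0)
    (hW : Module.finrank K W = 2) (huW : u ∈ W) (hwW : w ∈ W) (hw : w ∉ Submodule.span K {u}) :
    W = Submodule.span K {u, w} := by
  refine (Submodule.eq_of_le_of_finrank_eq ?_ ?_).symm
  · rw [Submodule.span_le]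
    rintro x (rfl | rfl) <;> assumption
  · rw [finrank_span_pair_of_notMem_span hu hw, hW]

theorem Submodule.exists_eq_of_finrank_eq_three [FiniteDimensional K V] {T : Submodule K V}
    (hT : Module.finrank K T = 3) {u a b : V} (hu : u ≠ 0) (huT : u ∈ T) (haT : a ∈ T)
    (hbT : b ∈ T) (ha : a ∉ Submodule.span K {u}) (hb : b ∉ Submodule.span K {u, a})
    {v : V} (hv : v ∈ T) : ∃ c x y : K, v = c • u + x • a + y • b := by
  have hlt : Submodule.span K {u, a} < Submodule.span K {u, a, b} := by
    refine lt_of_le_of_ne (Submodule.span_mono (by grind)) fun h => hb ?_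
    rw [h]
    exact Submodule.subset_span (by simp)
  have hle : Submodule.span K {u, a, b} ≤ T := by
    rw [Submodule.span_le]
    rintro x (rfl | rfl | rfl) <;> assumption
  have h1 := Submodule.finrank_lt_finrank_of_lt hlt
  rw [finrank_span_pair_of_notMem_span hu ha] at h1
  have h2 : Submodule.span K {u, a, b} = T :=
    Submodule.eq_of_le_of_finrank_le hle (by omega)
  rw [← h2, Submodule.mem_span_triple] at hv
  obtain ⟨c, x, y, h⟩ := hv
  exact ⟨c, x, y, h.symm⟩

/-- In a three-dimensional space `T`, the planes through a vector `u` of the radical of a bilinear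
form that are isotropic for the form are infinitely many, or one, or two. -/
theorem isotropic_planes_count [IsAlgClosed K] (h2 : (2 : K) ≠ 0) [FiniteDimensional K V]
    (T : Submodule K V) (hT : Module.finrank K T = 3) (B : V →ₗ[K] V →ₗ[K] K) {u : V}
    (hu : u ≠ 0) (huT : u ∈ T) (hBl : ∀ v ∈ T, B u v = 0) (hBr : ∀ v ∈ T, B v u = 0)
    {S : Set (Submodule K V)}
    (hS : ∀ W, W ∈ S ↔ Module.finrank K W = 2 ∧ u ∈ W ∧ ∀ v ∈ W, v ∈ T ∧ B v v = 0) :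
    S.Infinite ∨ S.ncard = 1 ∨ S.ncard = 2 := by
  classical
  have mem_S {w : V} (hwT : w ∈ T) (hw : w ∉ Submodule.span K {u}) (hB : B w w = 0) :
      Submodule.span K {u, w} ∈ S := by
    refine (hS _).2 ⟨finrank_span_pair_of_notMem_span hu hw, Submodule.subset_span (by simp),
      fun v hv => ?_⟩
    obtain ⟨s, t, rfl⟩ := Submodule.mem_span_pair.1 hv
    refine ⟨T.add_mem (T.smul_mem _ huT) (T.smul_mem _ hwT), ?_⟩
    simp [hB, hBl u huT, hBl w hwT, hBr w hwT]
  obtain ⟨a, haT, ha, haa⟩ : ∃ a ∈ T, a ∉ Submodule.span K {u} ∧ B a a = 0 := by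
    obtain ⟨a, haT, ha⟩ := T.exists_mem_notMem_span {u} (by simp [hT])
    obtain ⟨b, hbT, hb⟩ := T.exists_mem_notMem_span {u, a} (by
      have := Finset.card_le_two (a := u) (b := a)
      omega)
    simp only [Finset.coe_singleton, Finset.coe_insert] at ha hb
    by_cases haa : B a a = 0
    · exact ⟨a, haT, ha, haa⟩
    have : NeZero (2 : K) := ⟨h2⟩
    obtain ⟨s, hs⟩ := IsAlgClosed.exists_eq_mul_self (discrim (B a a) (B a b + B b a) (B b b))
    obtain ⟨x, hx⟩ := exists_quadratic_eq_zero haa ⟨s, hs⟩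
    refine ⟨x • a + b, T.add_mem (T.smul_mem _ haT) hbT, fun h => hb ?_, ?_⟩
    · obtain ⟨c, hc⟩ := Submodule.mem_span_singleton.1 h
      exact Submodule.mem_span_pair.2 ⟨c, -x, by rw [hc]; module⟩
    · simp only [map_add, map_smul, LinearMap.add_apply, LinearMap.smul_apply, smul_eq_mul]
      linear_combination hx
  obtain ⟨b, hbT, hb⟩ := T.exists_mem_notMem_span {u, a} (by
    have := Finset.card_le_two (a := u) (b := a)
    omega)
  simp only [Finset.coe_singleton, Finset.coe_insert] at hb
  have notMem (x y : K) (hy : y ≠ 0) : x • a + y • b ∉ Submodule.span K {u} := fun h => by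
    obtain ⟨c, hc⟩ := Submodule.mem_span_singleton.1 h
    refine hb (Submodule.mem_span_pair.2 ⟨y⁻¹ * c, -(y⁻¹ * x), ?_⟩)
    rw [mul_smul, hc, smul_add, smul_smul, smul_smul, inv_mul_cancel₀ hy]
    module
  have B_eq (x y : K) : B (x • a + y • b) (x • a + y • b) =
      y * ((B a b + B b a) * x + B b b * y) := by
    simp only [map_add, map_smul, LinearMap.add_apply, LinearMap.smul_apply, smul_eq_mul, haa]
    ring
  have memT (x y : K) : x • a + y • b ∈ T := T.add_mem (T.smul_mem _ haT) (T.smul_mem _ hbT)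
  by_cases h0 : B a b + B b a = 0 ∧ B b b = 0
  · left
    have : Infinite K := IsAlgClosed.instInfinite
    refine Set.infinite_of_injective_forall_mem
      (f := fun y : K => Submodule.span K {u, (y • a + (1 : K) • b)}) (fun y z hyz => ?_)
      fun y => mem_S (memT _ _) (notMem _ _ one_ne_zero) (by simp only [B_eq, h0]; ring)
    by_contra hne
    simp only at hyz
    have hy : y • a + (1 : K) • b ∈ Submodule.span K {u, y • a + (1 : K) • b} :=
      Submodule.subset_span (by simp)
    have hz : z • a + (1 : K) • b ∈ Submodule.span K {u, y • a + (1 : K) • b} := by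
      rw [hyz]; exact Submodule.subset_span (by simp)
    have haW : a ∈ Submodule.span K {u, y • a + (1 : K) • b} := by
      rw [← Submodule.smul_mem_iff _ (sub_ne_zero.2 hne)]
      convert Submodule.sub_mem _ hy hz using 1
      module
    have hbW : b ∈ Submodule.span K {u, y • a + (1 : K) • b} := by
      convert Submodule.sub_mem _ hy (Submodule.smul_mem _ y haW) using 1
      module
    rw [Submodule.eq_span_pair hu (finrank_span_pair_of_notMem_span hu (notMem _ _ one_ne_zero))
      (Submodule.subset_span (by simp)) haW ha] at hbW
    exact hb hbW
  right
  set m := B a b + B b a with hm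
  have key : ∀ W ∈ S, W = Submodule.span K {u, a} ∨
      m ≠ 0 ∧ W = Submodule.span K {u, (-B b b) • a + m • b} := by
    intro W hW
    obtain ⟨hW2, huW, hWT⟩ := (hS W).1 hW
    obtain ⟨w, hwW, hw⟩ := W.exists_mem_notMem_span {u} (by simp [hW2])
    obtain ⟨hwT, hww⟩ := hWT w hwW
    obtain ⟨c, x, y, rfl⟩ := Submodule.exists_eq_of_finrank_eq_three hT hu huT haT hbT ha hb hwT
    have hW' : x • a + y • b ∈ W := by
      convert W.sub_mem hwW (W.smul_mem c huW) using 1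
      module
    have hq := (hWT _ hW').2
    rw [B_eq] at hq
    by_cases hy : y = 0
    · subst hy
      have hx : x ≠ 0 := by
        rintro rfl
        apply hw
        simpa using Submodule.smul_mem _ c (Submodule.mem_span_singleton_self u)
      refine .inl (Submodule.eq_span_pair hu hW2 huW ?_ ha)
      simpa [Submodule.smul_mem_iff _ hx] using hW'
    · have hq := (mul_eq_zero.1 hq).resolve_left hy
      have hm0 : m ≠ 0 := by
        intro hm0
        rw [hm0, zero_mul, zero_add] at hq
        exact h0 ⟨hm0, (mul_eq_zero.1 hq).resolve_right hy⟩
      refine .inr ⟨hm0, Submodule.eq_span_pair hu hW2 huW ?_ (notMem _ _ hm0)⟩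
      rw [← Submodule.smul_mem_iff _ hy]
      convert W.smul_mem m hW' using 1
      have : m * x = -(B b b * y) := by linear_combination hq
      rw [smul_add, smul_add, smul_smul, smul_smul, smul_smul, smul_smul, this]
      congr 2 <;> ring
  have haS := mem_S haT ha haa
  by_cases hex : ∃ W ∈ S, W ≠ Submodule.span K {u, a}
  · obtain ⟨W, hWS, hne⟩ := hex
    right
    have : S = {Submodule.span K {u, a}, W} := by
      ext W'
      refine ⟨fun h => ?_, ?_⟩
      · rcases key W' h with h | ⟨-, h⟩
        · exact .inl h
        · exact .inr (h.trans ((key W hWS).resolve_left hne).2.symm)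
      · rintro (rfl | rfl) <;> assumption
    rw [this, Set.ncard_pair hne.symm]
  · left
    push Not at hex
    rw [Set.ncard_eq_one]
    exact ⟨_, Set.eq_singleton_iff_unique_mem.2 ⟨haS, hex⟩⟩

end IsotropicPlanes

theorem asymptotic_lines_count
    {K : Type*} [Field K] [IsAlgClosed K] (d : ℕ) (hd : 3 ≤ d)
    (hchar : ringChar K = 0 ∨ d < ringChar K)
    (f : MvPolynomial (Fin 4) K) (hf : IsSmoothSurfaceOfDegree f d)
    (u : Fin 4 → K) (hu : u ≠ 0) (huX : MvPolynomial.eval u f = 0) :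
    {W : Submodule K (Fin 4 → K) | Module.finrank K W = 2 ∧ u ∈ W ∧
        ∀ v ∈ W, LinearIndependent K ![u, v] → ordGE f u v 3}.Infinite ∨
      {W : Submodule K (Fin 4 → K) | Module.finrank K W = 2 ∧ u ∈ W ∧
        ∀ v ∈ W, LinearIndependent K ![u, v] → ordGE f u v 3}.ncard = 1 ∨
      {W : Submodule K (Fin 4 → K) | Module.finrank K W = 2 ∧ u ∈ W ∧
        ∀ v ∈ W, LinearIndependent K ![u, v] → ordGE f u v 3}.ncard = 2 := by
  classical
  obtain ⟨hhom, hsm⟩ := hf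
  have h2 : (2 : K) ≠ 0 := Ring.two_ne_zero (by omega)
  let L : (Fin 4 → K) →ₗ[K] K := Fintype.linearCombination K fun i => eval u (pderiv i f)
  let B : (Fin 4 → K) →ₗ[K] (Fin 4 → K) →ₗ[K] K :=
    Matrix.toLinearMap₂' K (Matrix.of fun i j => eval u (pderiv j (pderiv i f)))
  have L_apply (v) : L v = ∑ i, v i * eval u (pderiv i f) := rfl
  have B_apply (v w) : B v w = ∑ i, v i * ∑ j, w j * eval u (pderiv j (pderiv i f)) := by
    simp [B, Matrix.toLinearMap₂'_apply, Finset.mul_sum]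
  have hLu : L u = 0 := by rw [L_apply, hhom.sum_mul_eval_pderiv, huX, mul_zero]
  have hBr (v) (hv : L v = 0) : B v u = 0 := by
    simp only [B_apply, hhom.pderiv.sum_mul_eval_pderiv]
    simp only [mul_left_comm (_ : K) ((d - 1 : ℕ) : K)]
    rw [← Finset.mul_sum, ← L_apply, hv, mul_zero]
  have hB (v w) : B v w = B w v := by
    simp only [B_apply, Finset.mul_sum]
    rw [Finset.sum_comm]
    refine Finset.sum_congr rfl fun i _ => Finset.sum_congr rfl fun j _ => ?_
    rw [pderiv_pderiv_comm]
    ring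
  have hker : Module.finrank K (LinearMap.ker L) = 3 := by
    obtain ⟨i, hi⟩ := hsm u hu
    have hL : L ≠ 0 := fun h => hi <| by
      simpa [L_apply, Pi.single_apply] using LinearMap.congr_fun h (Pi.single i 1)
    have h1 := L.finrank_range_add_finrank_ker
    rw [LinearMap.range_eq_top.2 (LinearMap.surjective hL)] at h1
    simp only [finrank_top, Module.finrank_self, Module.finrank_fin_fun] at h1
    omega
  refine isotropic_planes_count h2 (LinearMap.ker L) hker B hu hLu
    (fun v hv => (hB u v).trans (hBr v hv)) (fun v hv => hBr v hv) fun W => ?_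
  refine and_congr_right fun _ => and_congr_right fun _ => forall₂_congr fun v _ => ?_
  rw [ordGE_three_iff h2, ← L_apply, ← B_apply, LinearMap.mem_ker]
  refine ⟨fun h => ?_, fun h _ => ⟨huX, h⟩⟩
  by_cases hli : LinearIndependent K ![u, v]
  · exact (h hli).2
  · rw [LinearIndependent.pair_iff' hu] at hli
    push Not at hli
    obtain ⟨c, rfl⟩ := hli
    simp [hLu, hBr u hLu]
end

section
/- Let X ⊂ P³(K) be a smooth surface of degree d ≥ 3 over an algebraically closed field K of characteristic 0 or of characteristic p > d. Then not every point of X is flecnodal; that is, there exists a point P ∈ X such that every line L through P satisfies i(P, L.X) ≤ 3. -/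
open MvPolynomial

namespace MvPolynomial

theorem pderiv_comm {K σ : Type*} [Field K] (i j : σ) (f : MvPolynomial σ K) :
    pderiv i (pderiv j f) = pderiv j (pderiv i f) := by
  classical
  have h : ⁅(pderiv i : Derivation K (MvPolynomial σ K) (MvPolynomial σ K)), pderiv j⁆ =
      (0 : Derivation K (MvPolynomial σ K) (MvPolynomial σ K)) := by
    apply MvPolynomial.derivation_ext
    intro l
    simp only [Derivation.commutator_apply, pderiv_X, Pi.single_apply, Derivation.zero_apply]
    split_ifs <;> simp
  have := congrArg (fun D => D f) h
  simpa [Derivation.commutator_apply, sub_eq_zero] using this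

section DirectionalDerivatives

variable {K : Type*} [Field K] {A : Type*} [CommRing A] [Algebra K A] {σ : Type*} [Fintype σ]

/-- The derivative of `f` at the point `u` in the direction `v`. -/
noncomputable def dirDeriv (f : MvPolynomial σ K) (u v : σ → A) : A :=
  ∑ i, v i * aeval u (pderiv i f)

/-- The second derivative of `f` at the point `u` in the directions `v` and `w`. -/
noncomputable def dirDeriv₂ (f : MvPolynomial σ K) (u v w : σ → A) : A :=
  ∑ i, v i * dirDeriv (pderiv i f) u w

/-- The third derivative of `f` at the point `u` in the directions `v`, `w` and `z`. -/
noncomputable def dirDeriv₃ (f : MvPolynomial σ K) (u v w z : σ → A) : A :=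
  ∑ i, v i * dirDeriv₂ (pderiv i f) u w z

theorem dirDeriv_add (f : MvPolynomial σ K) (u v w : σ → A) :
    dirDeriv f u (v + w) = dirDeriv f u v + dirDeriv f u w := by
  simp [dirDeriv, add_mul, Finset.sum_add_distrib]

theorem dirDeriv_smul (f : MvPolynomial σ K) (u v : σ → A) (c : A) :
    dirDeriv f u (c • v) = c * dirDeriv f u v := by
  simp [dirDeriv, Finset.mul_sum, mul_assoc]

@[simp] theorem dirDeriv_zero (f : MvPolynomial σ K) (u : σ → A) :
    dirDeriv f u (0 : σ → A) = 0 := by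
  simp [dirDeriv]

theorem dirDeriv₂_comm (f : MvPolynomial σ K) (u v w : σ → A) :
    dirDeriv₂ f u v w = dirDeriv₂ f u w v := by
  simp only [dirDeriv₂, dirDeriv, Finset.mul_sum]
  rw [Finset.sum_comm]
  refine Finset.sum_congr rfl fun i _ => Finset.sum_congr rfl fun j _ => ?_
  rw [pderiv_comm]; ring

theorem dirDeriv₂_add_left (f : MvPolynomial σ K) (u v v' w : σ → A) :
    dirDeriv₂ f u (v + v') w = dirDeriv₂ f u v w + dirDeriv₂ f u v' w := by
  simp [dirDeriv₂, add_mul, Finset.sum_add_distrib]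

theorem dirDeriv₂_smul_left (f : MvPolynomial σ K) (u v w : σ → A) (c : A) :
    dirDeriv₂ f u (c • v) w = c * dirDeriv₂ f u v w := by
  simp [dirDeriv₂, Finset.mul_sum, mul_assoc]

theorem dirDeriv₂_add_right (f : MvPolynomial σ K) (u v w w' : σ → A) :
    dirDeriv₂ f u v (w + w') = dirDeriv₂ f u v w + dirDeriv₂ f u v w' := by
  simp [dirDeriv₂_comm f u v, dirDeriv₂_add_left]

theorem dirDeriv₂_smul_right (f : MvPolynomial σ K) (u v w : σ → A) (c : A) :
    dirDeriv₂ f u v (c • w) = c * dirDeriv₂ f u v w := by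
  simp [dirDeriv₂_comm f u v, dirDeriv₂_smul_left]

@[simp] theorem dirDeriv₂_zero_left (f : MvPolynomial σ K) (u w : σ → A) :
    dirDeriv₂ f u (0 : σ → A) w = 0 := by
  simp [dirDeriv₂]

@[simp] theorem dirDeriv₂_zero_right (f : MvPolynomial σ K) (u w : σ → A) :
    dirDeriv₂ f u w (0 : σ → A) = 0 := by
  simp [dirDeriv₂]

theorem dirDeriv₃_comm_left (f : MvPolynomial σ K) (u v w z : σ → A) :
    dirDeriv₃ f u v w z = dirDeriv₃ f u w v z := by
  simp only [dirDeriv₃, dirDeriv₂, Finset.mul_sum]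
  rw [Finset.sum_comm]
  refine Finset.sum_congr rfl fun i _ => Finset.sum_congr rfl fun j _ => ?_
  rw [pderiv_comm]; ring

theorem dirDeriv₃_comm_right (f : MvPolynomial σ K) (u v w z : σ → A) :
    dirDeriv₃ f u v w z = dirDeriv₃ f u v z w := by
  simp only [dirDeriv₃]
  exact Finset.sum_congr rfl fun i _ => by rw [dirDeriv₂_comm]

theorem dirDeriv₃_add_left (f : MvPolynomial σ K) (u v v' w z : σ → A) :
    dirDeriv₃ f u (v + v') w z = dirDeriv₃ f u v w z + dirDeriv₃ f u v' w z := by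
  simp [dirDeriv₃, add_mul, Finset.sum_add_distrib]

theorem dirDeriv₃_smul_left (f : MvPolynomial σ K) (u v w z : σ → A) (c : A) :
    dirDeriv₃ f u (c • v) w z = c * dirDeriv₃ f u v w z := by
  simp [dirDeriv₃, Finset.mul_sum, mul_assoc]

theorem dirDeriv₃_smul_smul_smul (f : MvPolynomial σ K) (u v w z : σ → A) (a b c : A) :
    dirDeriv₃ f u (a • v) (b • w) (c • z) = a * b * c * dirDeriv₃ f u v w z := by
  rw [dirDeriv₃_smul_left, dirDeriv₃_comm_left, dirDeriv₃_smul_left, dirDeriv₃_comm_right,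
    dirDeriv₃_comm_left, dirDeriv₃_smul_left, dirDeriv₃_comm_left f u z, dirDeriv₃_comm_right,
    dirDeriv₃_comm_left]
  ring

/-- Euler's identity. -/
theorem IsHomogeneous.dirDeriv_self {f : MvPolynomial σ K} {n : ℕ} (hf : f.IsHomogeneous n)
    (u : σ → A) : dirDeriv f u u = n * MvPolynomial.aeval u f := by
  simpa [dirDeriv] using congrArg (MvPolynomial.aeval u) hf.sum_X_mul_pderiv

theorem IsHomogeneous.dirDeriv₂_self {f : MvPolynomial σ K} {n : ℕ} (hf : f.IsHomogeneous n)
    (u v : σ → A) : dirDeriv₂ f u v u = ((n - 1 : ℕ) : A) * dirDeriv f u v := by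
  simp only [dirDeriv₂, dirDeriv.eq_1 f, Finset.mul_sum]
  exact Finset.sum_congr rfl fun i _ => by rw [IsHomogeneous.dirDeriv_self hf.pderiv]; ring

theorem IsHomogeneous.dirDeriv₃_self {f : MvPolynomial σ K} {n : ℕ} (hf : f.IsHomogeneous n)
    (u v w : σ → A) : dirDeriv₃ f u v w u = ((n - 1 - 1 : ℕ) : A) * dirDeriv₂ f u v w := by
  simp only [dirDeriv₃, dirDeriv₂.eq_1 f, Finset.mul_sum]
  exact Finset.sum_congr rfl fun i _ => by rw [IsHomogeneous.dirDeriv₂_self hf.pderiv]; ring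

/-- Vanishing to third order along the line through `u` in the direction `v` only depends on `v`
modulo `u`. -/
theorem IsHomogeneous.dirDeriv_add_smul_self {f : MvPolynomial σ K} {n : ℕ}
    (hf : f.IsHomogeneous n) {u v : σ → A} (h0 : MvPolynomial.aeval u f = 0)
    (h1 : dirDeriv f u v = 0)
    (h2 : dirDeriv₂ f u v v = 0) (h3 : dirDeriv₃ f u v v v = 0) (c : A) :
    dirDeriv f u (v + c • u) = 0 ∧ dirDeriv₂ f u (v + c • u) (v + c • u) = 0 ∧
      dirDeriv₃ f u (v + c • u) (v + c • u) (v + c • u) = 0 := by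
  have e1 : dirDeriv f u (v + c • u) = 0 := by
    rw [dirDeriv_add, dirDeriv_smul, hf.dirDeriv_self, h0, h1]; ring
  have r2 (w : σ → A) : dirDeriv₂ f u (v + c • u) w =
      dirDeriv₂ f u v w + c * ((n - 1 : ℕ) : A) * dirDeriv f u w := by
    rw [dirDeriv₂_add_left, dirDeriv₂_smul_left, dirDeriv₂_comm f u u, hf.dirDeriv₂_self]; ring
  have r3 (w z : σ → A) : dirDeriv₃ f u (v + c • u) w z =
      dirDeriv₃ f u v w z + c * ((n - 1 - 1 : ℕ) : A) * dirDeriv₂ f u w z := by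
    rw [dirDeriv₃_add_left, dirDeriv₃_smul_left, dirDeriv₃_comm_left f u u,
      dirDeriv₃_comm_right f u w, hf.dirDeriv₃_self]; ring
  have e2 : dirDeriv₂ f u (v + c • u) (v + c • u) = 0 := by
    rw [r2, e1, dirDeriv₂_comm, r2, h1, h2]; ring
  have e2' : dirDeriv₂ f u v (v + c • u) = 0 := by
    rw [dirDeriv₂_comm, r2, h1, h2]; ring
  refine ⟨e1, e2, ?_⟩
  rw [r3, e2, dirDeriv₃_comm_left, r3, e2', dirDeriv₃_comm_right, dirDeriv₃_comm_left, r3, h3, h2]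
  ring

theorem map_dirDeriv {B : Type*} [CommRing B] [Algebra K B] (φ : A →ₐ[K] B)
    (f : MvPolynomial σ K) (u v : σ → A) :
    φ (dirDeriv f u v) = dirDeriv f (φ ∘ u) (φ ∘ v) := by
  simp only [dirDeriv, map_sum, map_mul, ← comp_aeval_apply, Function.comp_def]

theorem map_dirDeriv₂ {B : Type*} [CommRing B] [Algebra K B] (φ : A →ₐ[K] B)
    (f : MvPolynomial σ K) (u v w : σ → A) :
    φ (dirDeriv₂ f u v w) = dirDeriv₂ f (φ ∘ u) (φ ∘ v) (φ ∘ w) := by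
  simp only [dirDeriv₂, map_sum, map_mul, map_dirDeriv, Function.comp_apply]

theorem map_dirDeriv₃ {B : Type*} [CommRing B] [Algebra K B] (φ : A →ₐ[K] B)
    (f : MvPolynomial σ K) (u v w z : σ → A) :
    φ (dirDeriv₃ f u v w z) = dirDeriv₃ f (φ ∘ u) (φ ∘ v) (φ ∘ w) (φ ∘ z) := by
  simp only [dirDeriv₃, map_sum, map_mul, map_dirDeriv₂, Function.comp_apply]

end DirectionalDerivatives

section ChainRule

variable {K : Type*} [Field K] {S F : Type*} [CommRing S] [CommRing F] [Algebra K S] [Algebra K F]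
  [Algebra S F] [IsScalarTower K S F] {σ : Type*} [Fintype σ]

theorem derivation_aeval (δ : Derivation K S F) (f : MvPolynomial σ K) (u : σ → S) :
    δ (aeval u f) = dirDeriv f (algebraMap S F ∘ u) (δ ∘ u) := by
  classical
  have key (p : MvPolynomial σ K) : aeval (algebraMap S F ∘ u) p = algebraMap S F (aeval u p) :=
    aeval_algebraMap_apply F u p
  simp only [dirDeriv, key]
  induction f using MvPolynomial.induction_on with
  | C a => simp
  | add p q hp hq => simp [hp, hq, mul_add, Finset.sum_add_distrib]
  | mul_X p i hp =>
    simp only [map_mul, aeval_X, Derivation.leibniz, hp, pderiv_X, Algebra.smul_def,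
      Algebra.algebraMap_self, RingHom.id_apply, map_add, mul_add, Finset.sum_add_distrib,
        Finset.mul_sum, Function.comp_apply]
    congr 1
    · rw [Finset.sum_eq_single i]
      · simp [mul_comm]
      · intro j _ hj
        simp [hj.symm]
      · simp
    · exact Finset.sum_congr rfl fun j _ => by ring

theorem derivation_dirDeriv (δ : Derivation K S F) (f : MvPolynomial σ K) (u s : σ → S) :
    δ (dirDeriv f u s) = dirDeriv₂ f (algebraMap S F ∘ u) (algebraMap S F ∘ s) (δ ∘ u) +
      dirDeriv f (algebraMap S F ∘ u) (δ ∘ s) := by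
  have key (p : MvPolynomial σ K) : aeval (algebraMap S F ∘ u) p = algebraMap S F (aeval u p) :=
    aeval_algebraMap_apply F u p
  rw [dirDeriv, dirDeriv₂, dirDeriv.eq_1 f, ← Finset.sum_add_distrib, map_sum]
  refine Finset.sum_congr rfl fun i _ => ?_
  rw [Derivation.leibniz, derivation_aeval, key]
  simp only [Algebra.smul_def, Function.comp_apply]
  ring

theorem derivation_dirDeriv₂ (δ : Derivation K S F) (f : MvPolynomial σ K) (u s r : σ → S) :
    δ (dirDeriv₂ f u s r) =
      dirDeriv₃ f (algebraMap S F ∘ u) (algebraMap S F ∘ s) (algebraMap S F ∘ r) (δ ∘ u) +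
      dirDeriv₂ f (algebraMap S F ∘ u) (algebraMap S F ∘ s) (δ ∘ r) +
      dirDeriv₂ f (algebraMap S F ∘ u) (δ ∘ s) (algebraMap S F ∘ r) := by
  have key (p : MvPolynomial σ K) : dirDeriv p (algebraMap S F ∘ u) (algebraMap S F ∘ r) =
      algebraMap S F (dirDeriv p u r) :=
    (map_dirDeriv (IsScalarTower.toAlgHom K S F) p u r).symm
  rw [dirDeriv₂, dirDeriv₃, dirDeriv₂, dirDeriv₂, ← Finset.sum_add_distrib,
    ← Finset.sum_add_distrib, map_sum]
  refine Finset.sum_congr rfl fun i _ => ?_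
  rw [Derivation.leibniz, derivation_dirDeriv, key]
  simp only [Algebra.smul_def, Function.comp_apply]
  ring

end ChainRule

section LineRestriction

variable {K : Type*} [Field K] {A : Type*} [CommRing A] [Algebra K A] {σ : Type*}

/-- The restriction of `f` to the parametrized line `t ↦ u + t • v`. -/
noncomputable def lineRestriction (f : MvPolynomial σ K) (u v : σ → A) : Polynomial A :=
  aeval (fun i => Polynomial.C (u i) + Polynomial.X * Polynomial.C (v i)) f

theorem eval_lineRestriction (f : MvPolynomial σ K) (u v : σ → A) (t : A) :
    (lineRestriction f u v).eval t = aeval (u + t • v) f := by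
  have h := comp_aeval_apply (R := K)
    (fun i => Polynomial.C (u i) + Polynomial.X * Polynomial.C (v i))
    ((Polynomial.aeval (R := A) t).restrictScalars K) f
  simp only [AlgHom.restrictScalars_apply, Polynomial.coe_aeval_eq_eval] at h
  rw [lineRestriction, h]
  congr 2
  funext i
  simpa using mul_comm _ _

theorem coeff_zero_lineRestriction (f : MvPolynomial σ K) (u v : σ → A) :
    (lineRestriction f u v).coeff 0 = aeval u f := by
  rw [Polynomial.coeff_zero_eq_eval_zero, eval_lineRestriction, zero_smul, add_zero]

theorem IsHomogeneous.natDegree_lineRestriction_le {f : MvPolynomial σ K} {n : ℕ}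
    (hf : f.IsHomogeneous n) (u v : σ → A) : (lineRestriction f u v).natDegree ≤ n := by
  have h := aeval_natDegree_le _ (hf.map (algebraMap K A)).totalDegree_le
    (fun i => Polynomial.C (u i) + Polynomial.X * Polynomial.C (v i)) (n := 1) fun i => by
      compute_degree
  rwa [aeval_map_algebraMap, mul_one] at h

theorem derivative_lineRestriction [Fintype σ] (f : MvPolynomial σ K) (u v : σ → A) :
    Polynomial.derivative (lineRestriction f u v) =
      ∑ i, Polynomial.C (v i) * lineRestriction (pderiv i f) u v := by
  have h := derivation_aeval (S := Polynomial A) (F := Polynomial A)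
    (Polynomial.derivative'.restrictScalars K) f
    (fun i => Polynomial.C (u i) + Polynomial.X * Polynomial.C (v i))
  simpa [dirDeriv, lineRestriction, Function.comp_def] using h

theorem dirDeriv_eq_coeff [Fintype σ] (f : MvPolynomial σ K) (u v : σ → A) :
    dirDeriv f u v = (lineRestriction f u v).coeff 1 := by
  have h := congrArg (Polynomial.coeff · 0) (derivative_lineRestriction f u v)
  simp only [Polynomial.coeff_derivative, Polynomial.finsetSum_coeff, Polynomial.coeff_C_mul,
    coeff_zero_lineRestriction] at h
  simpa [dirDeriv] using h.symm

theorem dirDeriv₂_eq_coeff [Fintype σ] (f : MvPolynomial σ K) (u v : σ → A) :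
    dirDeriv₂ f u v v = 2 * (lineRestriction f u v).coeff 2 := by
  have h := congrArg (Polynomial.coeff · 1) (derivative_lineRestriction f u v)
  simp only [Polynomial.coeff_derivative, Polynomial.finsetSum_coeff, Polynomial.coeff_C_mul,
    ← dirDeriv_eq_coeff] at h
  rw [dirDeriv₂, ← h]
  push_cast; ring

theorem dirDeriv₃_eq_coeff [Fintype σ] (f : MvPolynomial σ K) (u v : σ → A) :
    dirDeriv₃ f u v v v = 6 * (lineRestriction f u v).coeff 3 := by
  have h := congrArg (2 * Polynomial.coeff · 2) (derivative_lineRestriction f u v)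
  simp only [Polynomial.coeff_derivative, Polynomial.finsetSum_coeff, Polynomial.coeff_C_mul,
    Finset.mul_sum, mul_left_comm (2 : A), ← dirDeriv₂_eq_coeff] at h
  rw [dirDeriv₃, ← h]
  push_cast; ring

theorem IsHomogeneous.aeval_smul {f : MvPolynomial σ K} {n : ℕ} (hf : f.IsHomogeneous n)
    (c : A) (x : σ → A) : MvPolynomial.aeval (c • x) f = c ^ n * MvPolynomial.aeval x f := by
  simp only [aeval_def, eval₂_eq, Finset.mul_sum]
  refine Finset.sum_congr rfl fun m hm => ?_
  have h : ∏ i ∈ m.support, c ^ m i = c ^ n := by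
    rw [Finset.prod_pow_eq_pow_sum, ← hf (mem_support_iff.mp hm)]
    simp [Finsupp.weight_apply, Finsupp.sum]
  simp only [Pi.smul_apply, smul_eq_mul, mul_pow, Finset.prod_mul_distrib, h]
  ring

theorem IsHomogeneous.coeff_lineRestriction {F : Type*} [Field F] [Infinite F]
    [Algebra K F] {f : MvPolynomial σ K} {n : ℕ} (hf : f.IsHomogeneous n) (u v : σ → F) :
    (lineRestriction f u v).coeff n = MvPolynomial.aeval v f := by
  have hr : lineRestriction f v u = (lineRestriction f u v).reflect n := by
    apply Polynomial.eq_of_infinite_eval_eq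
    refine Set.Infinite.mono ?_ (Set.Finite.infinite_compl (Set.finite_singleton (0 : F)))
    intro t (ht : t ≠ 0)
    let := invertibleOfNonzero (inv_ne_zero ht)
    have h := Polynomial.eval₂_reflect_mul_pow (RingHom.id F) t⁻¹ n (lineRestriction f u v)
      (hf.natDegree_lineRestriction_le u v)
    have e : u + t⁻¹ • v = t⁻¹ • (v + t • u) := by
      rw [smul_add, smul_smul, inv_mul_cancel₀ ht, one_smul, add_comm]
    rw [Polynomial.eval₂_id, Polynomial.eval₂_id, eval_lineRestriction f u v, e, hf.aeval_smul,
      invOf_eq_inv, inv_inv, mul_comm] at h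
    rw [Set.mem_ofPred_eq, eval_lineRestriction]
    exact (mul_left_cancel₀ (pow_ne_zero n (inv_ne_zero ht)) h).symm
  have h := congrArg (Polynomial.coeff · 0) hr
  simp only [coeff_zero_lineRestriction, Polynomial.coeff_reflect,
    Polynomial.revAt_le (Nat.zero_le n), Nat.sub_zero] at h
  exact h.symm

end LineRestriction

section Lines

variable {K : Type*} [Field K] {F : Type*} [Field F] [Algebra K F]

/-- If the tangent direction `v` at `u` is constant along a derivation `δ` moving `u` in the
direction `v`, then the line through `u` in the direction `v` is contained in `f = 0`. -/
theorem IsHomogeneous.lineRestriction_eq_zero [Infinite K] {σ : Type*} [Fintype σ]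
    {S : Type*} [Field S] [Algebra K S]
    [Algebra S F] [IsScalarTower K S F] {f : MvPolynomial σ K} {d : ℕ} (hf : f.IsHomogeneous d)
    (hchar : ∀ n : ℕ, n + 1 ≤ d → ((n + 1 : ℕ) : F) ≠ 0) {u v : σ → S} (δ : Derivation K S F)
    (hu : δ ∘ u = algebraMap S F ∘ v) (hv : δ ∘ v = 0) (h0 : MvPolynomial.aeval u f = 0) :
    lineRestriction f u v = 0 := by
  set Φ := lineRestriction f u v with hΦ
  set Ψ : Polynomial F := ∑ k ∈ Finset.range (Φ.natDegree + 1),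
    Polynomial.monomial k (δ (Φ.coeff k)) with hΨ
  have hcoeff (k : ℕ) : Ψ.coeff k = δ (Φ.coeff k) := by
    simp only [hΨ, Polynomial.finsetSum_coeff, Polynomial.coeff_monomial, Finset.sum_ite_eq',
      Finset.mem_range]
    split_ifs with h
    · rfl
    · rw [Polynomial.coeff_eq_zero_of_natDegree_lt (by omega), map_zero]
  have heval (t : K) : Ψ.eval (algebraMap K F t) = δ (Φ.eval (algebraMap K S t)) := by
    rw [Polynomial.eval_eq_sum_range (p := Φ), hΨ, Polynomial.eval_finsetSum, map_sum]
    refine Finset.sum_congr rfl fun k _ => ?_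
    rw [Polynomial.eval_monomial, Derivation.leibniz, ← map_pow, ← map_pow,
      Derivation.map_algebraMap, smul_zero, zero_add, Algebra.smul_def,
      ← IsScalarTower.algebraMap_apply, mul_comm]
  have heq : Ψ = (Polynomial.derivative Φ).map (algebraMap S F) := by
    apply Polynomial.eq_of_infinite_eval_eq
    refine (Set.infinite_range_of_injective (algebraMap K F).injective).mono ?_
    rintro _ ⟨t, rfl⟩
    rw [Set.mem_ofPred_eq, heval, hΦ, eval_lineRestriction, derivation_aeval,
      derivative_lineRestriction, IsScalarTower.algebraMap_apply K S F, Polynomial.eval_map_apply]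
    have e1 : δ ∘ (u + algebraMap K S t • v) = algebraMap S F ∘ v := by
      funext i
      have h1 := congrFun hu i
      have h2 := congrFun hv i
      simp only [Function.comp_apply, Pi.zero_apply] at h1 h2
      simp [h1, h2]
    rw [e1, ← IsScalarTower.coe_toAlgHom' K S F, ← map_dirDeriv]
    simp [dirDeriv, Polynomial.eval_finsetSum, eval_lineRestriction]
  have hrec (k : ℕ) : δ (Φ.coeff k) = algebraMap S F (Φ.coeff (k + 1)) * ((k + 1 : ℕ) : F) := by
    rw [← hcoeff, heq, Polynomial.coeff_map, Polynomial.coeff_derivative]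
    simp
  ext k
  rw [Polynomial.coeff_zero]
  induction k with
  | zero => rw [hΦ, coeff_zero_lineRestriction, h0]
  | succ k ih =>
    by_cases hk : k + 1 ≤ d
    · have h := hrec k
      rw [ih, map_zero, eq_comm, mul_eq_zero, or_iff_left (hchar k hk)] at h
      exact (map_eq_zero _).mp h
    · exact Polynomial.coeff_eq_zero_of_natDegree_lt
        (lt_of_le_of_lt (hf.natDegree_lineRestriction_le u v) (by omega))

/-- A line in a smooth surface of degree at least three does not deform, even to first order:
a deformation of the line through `u` in direction `v` is a field `w + t w'` along the line which
is tangent to the surface. -/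
theorem IsHomogeneous.not_deformation [IsAlgClosed F] {f : MvPolynomial (Fin 4) K} {d : ℕ}
    (hd : 3 ≤ d) (hf : f.IsHomogeneous d)
    (hsm : ∀ x : Fin 4 → F, (∀ i, MvPolynomial.aeval x (pderiv i f) = 0) → x = 0)
    {u v w w' z : Fin 4 → F} (hli : LinearIndependent F ![u, v, w, z])
    (hline : lineRestriction f u v = 0) :
    ∑ i, (Polynomial.C (w i) + Polynomial.X * Polynomial.C (w' i)) *
      lineRestriction (pderiv i f) u v ≠ 0 := by
  intro hrel
  have : Infinite F := IsAlgClosed.instInfinite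
  set P : (Fin 4 → F) →ₗ[F] Polynomial F :=
    Fintype.linearCombination F (fun i => lineRestriction (pderiv i f) u v) with hP
  have hPdef (x : Fin 4 → F) :
        P x = ∑ i, Polynomial.C (x i) * lineRestriction (pderiv i f) u v := by
    simp [hP, Fintype.linearCombination_apply, Polynomial.smul_eq_C_mul]
  have hPeval (x : Fin 4 → F) (t : F) : (P x).eval t = dirDeriv f (u + t • v) x := by
    simp [hPdef, dirDeriv, Polynomial.eval_finsetSum, eval_lineRestriction]
  have hPcoeff (x : Fin 4 → F) : (P x).coeff (d - 1) = dirDeriv f v x := by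
    simp [hPdef, dirDeriv, Polynomial.finsetSum_coeff, hf.pderiv.coeff_lineRestriction]
  have hPdeg (x : Fin 4 → F) : (P x).natDegree ≤ d - 1 := by
    rw [hPdef]
    refine Polynomial.natDegree_sum_le_of_forall_le _ _ fun i _ => ?_
    exact (Polynomial.natDegree_C_mul_le _ _).trans (hf.pderiv.natDegree_lineRestriction_le u v)
  have hPv : P v = 0 := by
    rw [hPdef, ← derivative_lineRestriction, hline, Polynomial.derivative_zero]
  have hPu : P u = 0 := by
    apply Polynomial.funext
    intro t
    have h : dirDeriv f (u + t • v) (u + t • v) = 0 := by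
      rw [hf.dirDeriv_self, ← eval_lineRestriction, hline]; simp
    have h' := hPeval v t
    rw [hPv, Polynomial.eval_zero] at h'
    rw [dirDeriv_add, dirDeriv_smul, ← h', mul_zero, add_zero] at h
    rw [hPeval, h, Polynomial.eval_zero]
  replace hrel : P w + Polynomial.X * P w' = 0 := by
    rw [← hrel, hPdef, hPdef, Finset.mul_sum, ← Finset.sum_add_distrib]
    exact Finset.sum_congr rfl fun i _ => by ring
  have hspan : Submodule.span F (Set.range ![u, v, w, z]) = ⊤ :=
    hli.span_eq_top_of_card_eq_finrank (by simp)
  have hcomb (x : Fin 4 → F) : ∃ a b c e : F, x = a • u + b • v + c • w + e • z := by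
    have hx : x ∈ Submodule.span F (Set.range ![u, v, w, z]) := hspan ▸ Submodule.mem_top
    obtain ⟨c, hc⟩ := (Submodule.mem_span_range_iff_exists_fun F).mp hx
    exact ⟨c 0, c 1, c 2, c 3, by rw [← hc]; simp [Fin.sum_univ_four]⟩
  have hnondeg (x : Fin 4 → F) (hx : x ≠ 0) (h1 : dirDeriv f x u = 0) (h2 : dirDeriv f x v = 0)
      (h3 : dirDeriv f x w = 0) (h4 : dirDeriv f x z = 0) : False := by
    refine hx (hsm x fun i => ?_)
    obtain ⟨a, b, c, e, h⟩ := hcomb (Pi.single i 1)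
    have : dirDeriv f x (Pi.single i 1) = 0 := by
      simp [h, dirDeriv_add, dirDeriv_smul, h1, h2, h3, h4]
    simpa [dirDeriv, Pi.single_apply] using this
  have hpair (a b : F) (h : a • u + b • v = 0) : a = 0 ∧ b = 0 := by
    have := Fintype.linearIndependent_iff.mp hli ![a, b, 0, 0]
        (by simpa [Fin.sum_univ_four] using h)
    exact ⟨this 0, this 1⟩
  have hroot (t : F) (h1 : (P w).eval t = 0) (h2 : (P z).eval t = 0) : False := by
    refine hnondeg (u + t • v) (fun h => ?_) (by rw [← hPeval, hPu]; simp)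
      (by rw [← hPeval, hPv]; simp) (by rw [← hPeval, h1]) (by rw [← hPeval, h2])
    exact one_ne_zero (hpair 1 t (by rwa [one_smul])).1
  have hinf (h1 : dirDeriv f v w = 0) (h2 : dirDeriv f v z = 0) : False := by
    refine hnondeg v (fun h => ?_) (by rw [← hPcoeff, hPu]; simp)
      (by rw [← hPcoeff, hPv]; simp) h1 h2
    exact one_ne_zero (hpair 0 1 (by simp [h])).2
  obtain ⟨a, b, c, e, hw'⟩ := hcomb w'
  have hPw' : P w' = c • P w + e • P z := by simp [hw', hPu, hPv]
  have htop : c * dirDeriv f v w + e * dirDeriv f v z = 0 := by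
    have h := congrArg (Polynomial.coeff · d) hrel
    obtain ⟨n, rfl⟩ : ∃ n, d = n + 1 := ⟨d - 1, by omega⟩
    have h' := Polynomial.coeff_eq_zero_of_natDegree_lt
        (lt_of_le_of_lt (hPdeg w) (Nat.lt_succ_self _))
    simp only [Nat.add_sub_cancel] at hPcoeff h'
    simpa [Polynomial.coeff_X_mul, h', hPw', hPcoeff] using h
  by_cases hn : dirDeriv f v w = 0
  · have hz : dirDeriv f v z ≠ 0 := fun h => hinf hn h
    have he : e = 0 := by simpa [hn, hz] using htop
    have hPw : P w = 0 := by
      have h : P w * (1 + Polynomial.X * Polynomial.C c) = 0 := by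
        rw [← hrel, hPw', he, Polynomial.smul_eq_C_mul]; simp; ring
      refine (mul_eq_zero.mp h).resolve_right fun h' => ?_
      simpa using congrArg (Polynomial.eval 0) h'
    obtain ⟨t, ht⟩ := IsAlgClosed.exists_root (P z) (fun h => hz (by
      rw [← hPcoeff]
      exact Polynomial.coeff_eq_zero_of_degree_lt
          (by rw [h]; exact_mod_cast (by omega : 0 < d - 1))))
    exact hroot t (by rw [hPw]; simp) ht
  · set κ := dirDeriv f v z / dirDeriv f v w with hκ
    have hc : c = - (e * κ) := by
      rw [hκ]; field_simp; linear_combination htop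
    have hPw : P w = - (Polynomial.X * Polynomial.C e) * (P z - κ • P w) := by
      rw [hPw', hc] at hrel
      simp only [Polynomial.smul_eq_C_mul, map_neg, map_mul] at hrel ⊢
      linear_combination hrel
    by_cases hdeg : (P z - κ • P w).degree = 0
    · obtain ⟨r, hr⟩ : ∃ r, P z - κ • P w = Polynomial.C r :=
        ⟨_, Polynomial.eq_C_of_degree_eq_zero hdeg⟩
      refine hn ?_
      rw [← hPcoeff, hPw, hr]
      have h1 : (-(Polynomial.X * Polynomial.C e) * Polynomial.C r).natDegree ≤ 1 := by
        compute_degree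
      exact Polynomial.coeff_eq_zero_of_natDegree_lt (by omega)
    · obtain ⟨t, ht⟩ := IsAlgClosed.exists_root _ hdeg
      have h1 : (P w).eval t = 0 := by
        rw [hPw, Polynomial.eval_mul, ht.eq_zero, mul_zero]
      refine hroot t h1 ?_
      simpa [h1] using ht.eq_zero

end Lines

section AsymptoticDirections

variable {K : Type*} [Field K] {S F : Type*} [Field S] [Field F] [Algebra K S] [Algebra K F]
  [Algebra S F] [IsScalarTower K S F]

/-- A tangent vector is determined by three coordinates if the derivative in the direction of the
fourth coordinate does not vanish. -/
theorem eq_zero_of_dirDeriv_eq_zero {f : MvPolynomial (Fin 4) K} {u : Fin 4 → F} {i j a b : Fin 4}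
    (hall : ∀ l, l = i ∨ l = j ∨ l = a ∨ l = b) (hi : aeval u (pderiv i f) ≠ 0)
    {x : Fin 4 → F} (hx : dirDeriv f u x = 0) (hj : x j = 0) (ha : x a = 0) (hb : x b = 0) :
    x = 0 := by
  have hne (l : Fin 4) (hl : l ≠ i) : x l = 0 := by
    rcases hall l with h | h | h | h
    · exact absurd h hl
    all_goals rw [h]; assumption
  have hxi : x i = 0 := by
    rw [dirDeriv, Finset.sum_eq_single i (fun l _ hl => by rw [hne l hl, zero_mul]) (by simp)] at hx
    exact (mul_eq_zero.mp hx).resolve_right hi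
  funext l
  by_cases hl : l = i
  · rw [hl, hxi, Pi.zero_apply]
  · exact hne l hl

/-- Let `v` be a normalized asymptotic direction at the generic point `u` of the surface `f = 0`.
If `v` osculates to third order, or if the second fundamental form vanishes and `v` is a coordinate
direction, then `v` is constant along any derivation moving `u` in the direction `v`. -/
theorem derivation_direction_eq_zero {f : MvPolynomial (Fin 4) K} (htwo : (2 : F) ≠ 0)
    {u p q : Fin 4 → S} {i j a b : Fin 4}
    (hall : ∀ l, l = i ∨ l = j ∨ l = a ∨ l = b) (hi : aeval u (pderiv i f) ≠ 0)
    (hp : dirDeriv f u p = 0) (hpj : p j = 0) (hpa : p a = 1) (hpb : p b = 0)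
    (hq : dirDeriv f u q = 0) (hqj : q j = 0) (hqa : q a = 0) (hqb : q b = 1)
    (hder : ∀ t : Fin 4 → F, dirDeriv f (algebraMap S F ∘ u) t = 0 →
      ∃ δ : Derivation K S F, δ ∘ u = t)
    {x : S} (h2 : dirDeriv₂ f u (p + x • q) (p + x • q) = 0)
    (h3 : dirDeriv₃ f u (p + x • q) (p + x • q) (p + x • q) = 0 ∧
      ¬ (dirDeriv₂ f u p p = 0 ∧ dirDeriv₂ f u p q = 0 ∧ dirDeriv₂ f u q q = 0) ∨ x = 0)
    (δ : Derivation K S F) (hδ : δ ∘ u = algebraMap S F ∘ (p + x • q)) :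
    δ ∘ (p + x • q) = 0 := by
  set v := p + x • q with hv
  have hv1 : dirDeriv f u v = 0 := by rw [hv, dirDeriv_add, dirDeriv_smul, hp, hq]; ring
  have hvj : v j = 0 := by simp [hv, hpj, hqj]
  have hva : v a = 1 := by simp [hv, hpa, hqa]
  have hvb : v b = x := by simp [hv, hpb, hqb]
  have m1 (s : Fin 4 → S) : dirDeriv f (algebraMap S F ∘ u) (algebraMap S F ∘ s) =
      algebraMap S F (dirDeriv f u s) := (map_dirDeriv (IsScalarTower.toAlgHom K S F) f u s).symm
  have m2 (s r : Fin 4 → S) :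
      dirDeriv₂ f (algebraMap S F ∘ u) (algebraMap S F ∘ s) (algebraMap S F ∘ r) =
      algebraMap S F (dirDeriv₂ f u s r) :=
    (map_dirDeriv₂ (IsScalarTower.toAlgHom K S F) f u s r).symm
  have m3 (s r w : Fin 4 → S) :
      dirDeriv₃ f (algebraMap S F ∘ u) (algebraMap S F ∘ s) (algebraMap S F ∘ r)
        (algebraMap S F ∘ w) = algebraMap S F (dirDeriv₃ f u s r w) :=
    (map_dirDeriv₃ (IsScalarTower.toAlgHom K S F) f u s r w).symm
  have hiF : aeval (algebraMap S F ∘ u) (pderiv i f) ≠ 0 := by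
    have h : aeval (algebraMap S F ∘ u) (pderiv i f) = algebraMap S F (aeval u (pderiv i f)) :=
      aeval_algebraMap_apply F u _
    rw [h]
    exact (map_ne_zero _).mpr hi
  have key (D : Derivation K S F) (s : Fin 4 → S) (hs : dirDeriv f u s = 0) (hsj : s j = 0)
      (hsa : s a = 0 ∨ s a = 1)
      (hD : dirDeriv₂ f (algebraMap S F ∘ u) (algebraMap S F ∘ s) (D ∘ u) = 0) :
      D ∘ s = D (s b) • (algebraMap S F ∘ q) := by
    have h := derivation_dirDeriv D f u s
    rw [hs, map_zero, hD, zero_add] at h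
    refine sub_eq_zero.mp (eq_zero_of_dirDeriv_eq_zero (x := D ∘ s - D (s b) • (algebraMap S F ∘ q))
      hall hiF ?_ ?_ ?_ ?_)
    · rw [sub_eq_add_neg, ← neg_smul, dirDeriv_add, dirDeriv_smul, ← h, m1, hq, map_zero]
      ring
    · simp [hsj, hqj]
    · rcases hsa with h | h <;> simp [h, hqa]
    · simp [hqb]
  have hδv : δ ∘ v = δ x • (algebraMap S F ∘ q) := by
    rw [← hvb]
    exact key δ v hv1 hvj (Or.inr hva) (by rw [hδ, m2, h2, map_zero])
  rcases h3 with ⟨h3v, h3'⟩ | h3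
  swap
  · rw [hδv, h3, map_zero, zero_smul]
  by_contra hne
  have hy : δ x ≠ 0 := fun h => hne (by rw [hδv, h, zero_smul])
  have hvq : dirDeriv₂ f u v q = 0 := by
    have h := derivation_dirDeriv₂ δ f u v v
    rw [h2, map_zero, hδ, m3, h3v, map_zero, hδv, dirDeriv₂_smul_right, dirDeriv₂_smul_left,
      dirDeriv₂_comm f _ (algebraMap S F ∘ q), m2] at h
    have h' : 2 * δ x * algebraMap S F (dirDeriv₂ f u v q) = 0 := by linear_combination -h
    exact (map_eq_zero _).mp ((mul_eq_zero.mp h').resolve_left (mul_ne_zero htwo hy))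
  have hδq : δ ∘ q = 0 := by
    rw [key δ q hq hqj (Or.inl hqa) (by rw [hδ, m2, dirDeriv₂_comm, hvq, map_zero]), hqb,
      Derivation.map_one_eq_zero, zero_smul]
  obtain ⟨δ', hδ'⟩ := hder (algebraMap S F ∘ q) (by rw [m1, hq, map_zero])
  have hδ'v : δ' ∘ v = δ' x • (algebraMap S F ∘ q) := by
    rw [← hvb]
    exact key δ' v hv1 hvj (Or.inr hva) (by rw [hδ', m2, hvq, map_zero])
  have hvvq : dirDeriv₃ f u v v q = 0 := by
    have h := derivation_dirDeriv₂ δ' f u v v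
    rw [h2, map_zero, hδ', m3, hδ'v, dirDeriv₂_smul_right, dirDeriv₂_smul_left,
      dirDeriv₂_comm f _ (algebraMap S F ∘ q), m2, hvq, map_zero] at h
    exact (map_eq_zero (algebraMap S F)).mp (by linear_combination -h)
  have hqq : dirDeriv₂ f u q q = 0 := by
    have h := derivation_dirDeriv₂ δ f u v q
    rw [hvq, map_zero, hδ, m3, dirDeriv₃_comm_right, hvvq, hδq, dirDeriv₂_zero_right, hδv,
      dirDeriv₂_smul_left, m2, map_zero] at h
    have h' : δ x * algebraMap S F (dirDeriv₂ f u q q) = 0 := by linear_combination -h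
    exact (map_eq_zero _).mp ((mul_eq_zero.mp h').resolve_left hy)
  have hpq : dirDeriv₂ f u p q = 0 := by
    rw [hv, dirDeriv₂_add_left, dirDeriv₂_smul_left, hqq] at hvq
    linear_combination hvq
  refine h3' ⟨?_, hpq, hqq⟩
  rw [hv, dirDeriv₂_add_left, dirDeriv₂_smul_left, dirDeriv₂_add_right, dirDeriv₂_smul_right,
    dirDeriv₂_add_right, dirDeriv₂_smul_right, hqq, dirDeriv₂_comm f u q, hpq] at h2
  linear_combination h2

end AsymptoticDirections

section NoAsymptoticDirection

variable {K : Type*} [Field K] {S F : Type*} [Field S] [Field F] [Algebra K S] [Algebra K F]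
  [Algebra S F] [IsScalarTower K S F]

theorem map_lineRestriction {σ : Type*} (f : MvPolynomial σ K) (u v : σ → S) :
    (lineRestriction f u v).map (algebraMap S F) =
      lineRestriction f (algebraMap S F ∘ u) (algebraMap S F ∘ v) := by
  have h := comp_aeval_apply (R := K)
    (fun i => Polynomial.C (u i) + Polynomial.X * Polynomial.C (v i))
    (Polynomial.mapAlgHom (IsScalarTower.toAlgHom K S F)) f
  simpa [lineRestriction] using h

/-- A generic point of a smooth surface does not have a normalized direction `p + x • q` which
satisfies the conditions of `derivation_direction_eq_zero`: its line would be contained in the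
surface, and deforming the line in the direction of `q` would produce a singular point. -/
theorem IsHomogeneous.false_of_asymptotic_direction [Infinite K] [IsAlgClosed F]
    {f : MvPolynomial (Fin 4) K} {d : ℕ} (hd : 3 ≤ d) (hf : f.IsHomogeneous d)
    (hchar : ∀ n : ℕ, n + 1 ≤ d → ((n + 1 : ℕ) : F) ≠ 0)
    (hsm : ∀ x : Fin 4 → F, (∀ i, MvPolynomial.aeval x (pderiv i f) = 0) → x = 0)
    {u p q : Fin 4 → S} {i j a b : Fin 4} (h0 : MvPolynomial.aeval u f = 0) (huj : u j ≠ 0)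
    (hall : ∀ l, l = i ∨ l = j ∨ l = a ∨ l = b) (hi : MvPolynomial.aeval u (pderiv i f) ≠ 0)
    (hp : dirDeriv f u p = 0) (hpj : p j = 0) (hpa : p a = 1) (hpb : p b = 0)
    (hq : dirDeriv f u q = 0) (hqj : q j = 0) (hqa : q a = 0) (hqb : q b = 1)
    (hder : ∀ t : Fin 4 → F, dirDeriv f (algebraMap S F ∘ u) t = 0 →
      ∃ δ : Derivation K S F, δ ∘ u = t)
    {x : S} (h2 : dirDeriv₂ f u (p + x • q) (p + x • q) = 0)
    (h3 : dirDeriv₃ f u (p + x • q) (p + x • q) (p + x • q) = 0 ∧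
      ¬ (dirDeriv₂ f u p p = 0 ∧ dirDeriv₂ f u p q = 0 ∧ dirDeriv₂ f u q q = 0) ∨ x = 0) :
    False := by
  have hv1 : dirDeriv f u (p + x • q) = 0 := by rw [dirDeriv_add, dirDeriv_smul, hp, hq]; ring
  have m1 (s : Fin 4 → S) : dirDeriv f (algebraMap S F ∘ u) (algebraMap S F ∘ s) =
      algebraMap S F (dirDeriv f u s) := (map_dirDeriv (IsScalarTower.toAlgHom K S F) f u s).symm
  obtain ⟨δ, hδ⟩ := hder (algebraMap S F ∘ (p + x • q)) (by rw [m1, hv1, map_zero])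
  have hδv := derivation_direction_eq_zero (hchar 1 (by omega)) hall hi hp hpj hpa hpb
    hq hqj hqa hqb hder h2 h3 δ hδ
  have hvj : (p + x • q) j = 0 := by simp [hpj, hqj]
  have hva : (p + x • q) a = 1 := by simp [hpa, hqa]
  generalize p + x • q = v at *
  have hline := hf.lineRestriction_eq_zero hchar δ hδ hδv h0
  obtain ⟨δ', hδ'⟩ := hder (algebraMap S F ∘ q) (by rw [m1, hq, map_zero])
  have hlineF : lineRestriction f (algebraMap S F ∘ u) (algebraMap S F ∘ v) = 0 := by
    rw [← map_lineRestriction, hline, Polynomial.map_zero]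
  have hli : LinearIndependent F ![algebraMap S F ∘ u, algebraMap S F ∘ v, algebraMap S F ∘ q,
      Pi.single i 1] := by
    have hz : dirDeriv f (algebraMap S F ∘ u) (Pi.single i 1) ≠ 0 := by
      have h : dirDeriv f u (Pi.single i 1) = MvPolynomial.aeval u (pderiv i f) := by
        simp [dirDeriv, Pi.single_apply]
      have e : (Pi.single i 1 : Fin 4 → F) = algebraMap S F ∘ Pi.single i 1 := by
        funext l; simp [Pi.single_apply, apply_ite (algebraMap S F)]
      rw [e, m1, h]
      exact (map_ne_zero _).mpr hi
    rw [Fintype.linearIndependent_iff]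
    intro c hc
    simp only [Fin.sum_univ_four, Matrix.cons_val] at hc
    have h3 : c 3 = 0 := by
      have h := congrArg (dirDeriv f (algebraMap S F ∘ u)) hc
      simp only [dirDeriv_add, dirDeriv_smul, dirDeriv_zero, m1, hv1, hq, hf.dirDeriv_self u, h0,
        mul_zero, map_zero, zero_add] at h
      exact (mul_eq_zero.mp h).resolve_right hz
    have hj := congrFun hc j
    have ha := congrFun hc a
    have hb := congrFun hc b
    simp [h3, hvj, hqj, huj] at hj
    simp [h3, hj, hva, hqa] at ha
    simp [h3, hj, ha, hqb] at hb
    intro l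
    fin_cases l <;> assumption
  refine hf.not_deformation hd hsm hli hlineF (w := algebraMap S F ∘ q) (w' := δ' ∘ v) ?_
  refine Polynomial.eq_zero_of_infinite_isRoot _ (Set.Infinite.mono ?_
    (Set.infinite_range_of_injective (algebraMap K F).injective))
  rintro _ ⟨c, rfl⟩
  have h := derivation_aeval δ' f (u + algebraMap K S c • v)
  rw [← eval_lineRestriction, hline, Polynomial.eval_zero, map_zero] at h
  have e1 : algebraMap S F ∘ (u + algebraMap K S c • v) =
      algebraMap S F ∘ u + algebraMap K F c • (algebraMap S F ∘ v) := by
    funext l; simp [Algebra.smul_def, ← IsScalarTower.algebraMap_apply]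
  have e2 : δ' ∘ (u + algebraMap K S c • v) =
      algebraMap S F ∘ q + algebraMap K F c • (δ' ∘ v) := by
    funext l
    have := congrFun hδ' l
    simp only [Function.comp_apply] at this
    simp [← IsScalarTower.algebraMap_apply, this, Algebra.smul_def]
  rw [e1, e2] at h
  simpa [Polynomial.eval_finsetSum, eval_lineRestriction, dirDeriv, Algebra.smul_def,
    mul_comm (δ' _)] using h.symm

end NoAsymptoticDirection

section GenericPoint

theorem isSeparable_of_quadratic_eq_zero {k F : Type*} [Field k] [Field F] [Algebra k F]
    (htwo : (2 : k) ≠ 0) {A B C : k} (h : ¬ (A = 0 ∧ B = 0 ∧ C = 0)) {x : F}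
    (hx : algebraMap k F A + 2 * algebraMap k F B * x + algebraMap k F C * x ^ 2 = 0) :
    IsSeparable k x := by
  set P : Polynomial k := Polynomial.C C * Polynomial.X ^ 2 + Polynomial.C (2 * B) * Polynomial.X +
    Polynomial.C A with hP
  have hP0 : P ≠ 0 := by
    intro h0
    have c0 := congrArg (Polynomial.coeff · 0) h0
    have c1 := congrArg (Polynomial.coeff · 1) h0
    have c2 := congrArg (Polynomial.coeff · 2) h0
    simp [hP, -map_mul, Polynomial.coeff_X, Polynomial.coeff_C] at c0 c1 c2
    exact h ⟨c0, c1.resolve_left htwo, c2⟩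
  have hPx : Polynomial.aeval x P = 0 := by
    simp only [hP, map_add, map_mul, map_pow, Polynomial.aeval_X, Polynomial.aeval_C, map_ofNat]
    linear_combination hx
  have hint : IsIntegral k x := isAlgebraic_iff_isIntegral.mp ⟨P, hP0, hPx⟩
  have hdeg : (minpoly k x).natDegree ≤ 2 :=
    (Polynomial.natDegree_le_of_dvd (minpoly.dvd k x hPx) hP0).trans
      Polynomial.natDegree_quadratic_le
  have hpos := minpoly.natDegree_pos hint
  rw [IsSeparable, Polynomial.separable_iff_derivative_ne_zero (minpoly.irreducible hint)]
  intro h0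
  have hc := congrArg (Polynomial.coeff · ((minpoly k x).natDegree - 1)) h0
  simp only [Polynomial.coeff_derivative, Nat.sub_add_cancel hpos, Polynomial.coeff_natDegree,
    (minpoly.monic hint).leadingCoeff, Polynomial.coeff_zero, one_mul] at hc
  interval_cases hn : (minpoly k x).natDegree
  · simp at hc
  · apply htwo
    rw [← hc]; norm_num

variable {K : Type*} [Field K] {k S F : Type*} [Field k] [Field S] [Field F] [Algebra K k]
  [Algebra K S] [Algebra K F] [Algebra k S] [Algebra k F] [Algebra S F] [IsScalarTower K k S]
  [IsScalarTower K k F] [IsScalarTower K S F] [IsScalarTower k S F]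

/-- A generic point of a smooth surface is not flecnodal. -/
theorem IsHomogeneous.exists_eq_smul_of_flecnodal_direction [Infinite K] [IsAlgClosed F]
    {f : MvPolynomial (Fin 4) K} {d : ℕ} (hd : 3 ≤ d) (hf : f.IsHomogeneous d)
    (hchar : ∀ n : ℕ, n + 1 ≤ d → ((n + 1 : ℕ) : F) ≠ 0)
    (hsm : ∀ x : Fin 4 → F, (∀ i, MvPolynomial.aeval x (pderiv i f) = 0) → x = 0)
    {u : Fin 4 → k} (hu : u ≠ 0) (h0 : MvPolynomial.aeval u f = 0)
    (hreg : ∃ i, MvPolynomial.aeval u (pderiv i f) ≠ 0)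
    (hder : ∀ t : Fin 4 → F, dirDeriv f (algebraMap k F ∘ u) t = 0 →
      ∃ δ : Derivation K S F, δ ∘ (algebraMap k S ∘ u) = t)
    (hsep : ∀ x : F, IsSeparable k x → ∃ s : S, algebraMap S F s = x)
    {v : Fin 4 → F} (h1 : dirDeriv f (algebraMap k F ∘ u) v = 0)
    (h2 : dirDeriv₂ f (algebraMap k F ∘ u) v v = 0)
    (h3 : dirDeriv₃ f (algebraMap k F ∘ u) v v v = 0) :
    ∃ c : F, v = c • (algebraMap k F ∘ u) := by
  obtain ⟨i, hi⟩ := hreg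
  obtain ⟨j, hji, huj⟩ : ∃ j, j ≠ i ∧ u j ≠ 0 := by
    by_contra! hcon
    have h := hf.dirDeriv_self u
    rw [h0, mul_zero, dirDeriv, Finset.sum_eq_single i
      (fun l _ hl => by rw [hcon l hl, zero_mul]) (by simp)] at h
    refine hu (_root_.funext fun l => ?_)
    by_cases hl : l = i
    · rw [hl]; exact (mul_eq_zero.mp h).resolve_right hi
    · exact hcon l hl
  set U := algebraMap k F ∘ u with hU
  have hUj : U j ≠ 0 := (map_ne_zero _).mpr huj
  have m0 (g : MvPolynomial (Fin 4) K) : MvPolynomial.aeval U g =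
      algebraMap k F (MvPolynomial.aeval u g) := aeval_algebraMap_apply F u _
  have hUi : MvPolynomial.aeval U (pderiv i f) ≠ 0 := by
    rw [m0]; exact (map_ne_zero _).mpr hi
  by_contra! hne
  obtain ⟨w1, w2, w3⟩ := hf.dirDeriv_add_smul_self (by rw [m0, h0, map_zero]) h1 h2 h3
    (-(v j / U j))
  have hw0 : v + (-(v j / U j)) • U ≠ 0 := by
    intro h
    refine hne (v j / U j) ?_
    rw [neg_smul] at h
    exact add_neg_eq_zero.mp h
  have hwj : (v + (-(v j / U j)) • U) j = 0 := by
    simp only [Pi.add_apply, Pi.smul_apply, smul_eq_mul]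
    field_simp
    ring
  generalize v + (-(v j / U j)) • U = w at *
  obtain ⟨a, b, hall, hai, haj, hbi, hbj, hab, hwa⟩ : ∃ a b : Fin 4,
      (∀ l, l = i ∨ l = j ∨ l = a ∨ l = b) ∧ a ≠ i ∧ a ≠ j ∧ b ≠ i ∧ b ≠ j ∧ a ≠ b ∧ w a ≠ 0 := by
    obtain ⟨a, b, hall, hai, haj, hbi, hbj, hab⟩ : ∃ a b : Fin 4,
        (∀ l, l = i ∨ l = j ∨ l = a ∨ l = b) ∧ a ≠ i ∧ a ≠ j ∧ b ≠ i ∧ b ≠ j ∧ a ≠ b := by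
      have h : ∀ i j : Fin 4, j ≠ i → ∃ a b : Fin 4,
          (∀ l, l = i ∨ l = j ∨ l = a ∨ l = b) ∧ a ≠ i ∧ a ≠ j ∧ b ≠ i ∧ b ≠ j ∧ a ≠ b := by
        decide
      exact h i j hji
    by_cases hwa : w a = 0
    · refine ⟨b, a, fun l => ?_, hbi, hbj, hai, haj, hab.symm, fun hwb => hw0 ?_⟩
      · rw [or_comm (a := l = b)]; exact hall l
      · exact eq_zero_of_dirDeriv_eq_zero hall hUi w1 hwj hwa hwb
    · exact ⟨a, b, hall, hai, haj, hbi, hbj, hab, hwa⟩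
  have hbasis (c : Fin 4) : dirDeriv f u (Pi.single c 1 -
      (MvPolynomial.aeval u (pderiv c f) / MvPolynomial.aeval u (pderiv i f)) • Pi.single i 1) =
      0 := by
    have h (l : Fin 4) : dirDeriv f u (Pi.single l 1) = MvPolynomial.aeval u (pderiv l f) := by
      simp [dirDeriv, Pi.single_apply]
    rw [sub_eq_add_neg, ← neg_smul, dirDeriv_add, dirDeriv_smul, h, h]
    field_simp
    ring
  have hp := hbasis a
  have hq := hbasis b
  set p := Pi.single a 1 - (MvPolynomial.aeval u (pderiv a f) /
    MvPolynomial.aeval u (pderiv i f)) • Pi.single i 1 with hp_def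
  set q := Pi.single b 1 - (MvPolynomial.aeval u (pderiv b f) /
    MvPolynomial.aeval u (pderiv i f)) • Pi.single i 1 with hq_def
  have hpj : p j = 0 := by simp [hp_def, haj.symm, hji]
  have hpa : p a = 1 := by simp [hp_def, hai]
  have hpb : p b = 0 := by simp [hp_def, hab.symm, hbi]
  have hqj : q j = 0 := by simp [hq_def, hbj.symm, hji]
  have hqa : q a = 0 := by simp [hq_def, hab, hai]
  have hqb : q b = 1 := by simp [hq_def, hbi]
  have m1 (s : Fin 4 → k) : dirDeriv f U (algebraMap k F ∘ s) = algebraMap k F (dirDeriv f u s) :=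
    (map_dirDeriv (IsScalarTower.toAlgHom K k F) f u s).symm
  have m2 (s r : Fin 4 → k) : dirDeriv₂ f U (algebraMap k F ∘ s) (algebraMap k F ∘ r) =
      algebraMap k F (dirDeriv₂ f u s r) :=
    (map_dirDeriv₂ (IsScalarTower.toAlgHom K k F) f u s r).symm
  obtain ⟨x, hx⟩ : ∃ x : F, (w a)⁻¹ • w = algebraMap k F ∘ p + x • (algebraMap k F ∘ q) := by
    refine ⟨(w a)⁻¹ * w b, sub_eq_zero.mp (eq_zero_of_dirDeriv_eq_zero hall hUi ?_ ?_ ?_ ?_)⟩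
    · rw [sub_eq_add_neg, ← neg_one_smul F, dirDeriv_add, dirDeriv_smul, dirDeriv_smul, w1,
        dirDeriv_add, dirDeriv_smul, m1, m1, hp, hq, map_zero]
      ring
    · simp [hwj, hpj, hqj]
    · simp [hpa, hqa, hwa]
    · simp [hpb, hqb]
  have z2 : dirDeriv₂ f U (algebraMap k F ∘ p + x • (algebraMap k F ∘ q))
      (algebraMap k F ∘ p + x • (algebraMap k F ∘ q)) = 0 := by
    rw [← hx, dirDeriv₂_smul_left, dirDeriv₂_smul_right, w2, mul_zero, mul_zero]
  have z3 : dirDeriv₃ f U (algebraMap k F ∘ p + x • (algebraMap k F ∘ q))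
      (algebraMap k F ∘ p + x • (algebraMap k F ∘ q))
      (algebraMap k F ∘ p + x • (algebraMap k F ∘ q)) = 0 := by
    rw [← hx, dirDeriv₃_smul_smul_smul, w3, mul_zero]
  have htwo : (2 : F) ≠ 0 := hchar 1 (by omega)
  -- everything descends to the separable closure
  have comp (s : Fin 4 → k) : algebraMap S F ∘ (algebraMap k S ∘ s) = algebraMap k F ∘ s := by
    funext l; exact (IsScalarTower.algebraMap_apply k S F _).symm
  have n0 (g : MvPolynomial (Fin 4) K) : MvPolynomial.aeval (algebraMap k S ∘ u) g =
      algebraMap k S (MvPolynomial.aeval u g) := aeval_algebraMap_apply S u _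
  have n1 (s : Fin 4 → k) : dirDeriv f (algebraMap k S ∘ u) (algebraMap k S ∘ s) =
      algebraMap k S (dirDeriv f u s) := (map_dirDeriv (IsScalarTower.toAlgHom K k S) f u s).symm
  have n2 (s r : Fin 4 → k) :
      dirDeriv₂ f (algebraMap k S ∘ u) (algebraMap k S ∘ s) (algebraMap k S ∘ r) =
      algebraMap k S (dirDeriv₂ f u s r) :=
    (map_dirDeriv₂ (IsScalarTower.toAlgHom K k S) f u s r).symm
  have final (y : S) := hf.false_of_asymptotic_direction (F := F) hd hchar hsm
    (u := algebraMap k S ∘ u) (p := algebraMap k S ∘ p) (q := algebraMap k S ∘ q) (i := i) (j := j)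
    (a := a) (b := b) (by rw [n0, h0, map_zero]) (by simpa using huj) hall
    (by rw [n0]; exact (map_ne_zero _).mpr hi) (by rw [n1, hp, map_zero]) (by simp [hpj])
    (by simp [hpa]) (by simp [hpb]) (by rw [n1, hq, map_zero]) (by simp [hqj])
    (by simp [hqa]) (by simp [hqb]) (by rw [comp]; exact hder) (x := y)
  by_cases hABC : dirDeriv₂ f u p p = 0 ∧ dirDeriv₂ f u p q = 0 ∧ dirDeriv₂ f u q q = 0
  · refine final 0 ?_ (Or.inr rfl)
    rw [zero_smul, add_zero, n2, hABC.1, map_zero]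
  · obtain ⟨y, rfl⟩ := hsep x (by
      refine isSeparable_of_quadratic_eq_zero (fun h => htwo ?_) hABC ?_
      · rw [← map_ofNat (algebraMap k F) 2, h, map_zero]
      · rw [dirDeriv₂_add_left, dirDeriv₂_smul_left, dirDeriv₂_add_right, dirDeriv₂_smul_right,
          dirDeriv₂_add_right, dirDeriv₂_smul_right, m2, m2, m2, m2, dirDeriv₂_comm f u q] at z2
        linear_combination z2)
    have hv : algebraMap k F ∘ p + algebraMap S F y • (algebraMap k F ∘ q) =
        algebraMap S F ∘ (algebraMap k S ∘ p + y • (algebraMap k S ∘ q)) := by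
      rw [← comp, ← comp]; funext l; simp [Algebra.smul_def]
    rw [hv, hU, ← comp] at z2 z3
    refine final y ?_ (Or.inl ⟨?_, ?_⟩)
    · rw [← map_eq_zero (algebraMap S F), ← z2]
      exact map_dirDeriv₂ (IsScalarTower.toAlgHom K S F) f _ _ _
    · rw [← map_eq_zero (algebraMap S F), ← z3]
      exact map_dirDeriv₃ (IsScalarTower.toAlgHom K S F) f _ _ _ _
    · rwa [n2, n2, n2, map_eq_zero, map_eq_zero, map_eq_zero]

end GenericPoint

section Derivations

theorem _root_.Derivation.exists_extension_of_formallyEtale {K R S F : Type*} [CommRing K]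
    [CommRing R] [CommRing S] [CommRing F] [Algebra K R] [Algebra K S] [Algebra K F] [Algebra R S]
    [Algebra R F] [Algebra S F] [IsScalarTower K R S] [IsScalarTower K R F] [IsScalarTower K S F]
    [IsScalarTower R S F] [Algebra.FormallyEtale R S] (D : Derivation K R F) :
    ∃ D' : Derivation K S F, ∀ r, D' (algebraMap R S r) = D r := by
  let e := KaehlerDifferential.tensorKaehlerEquivOfFormallyEtale K R S
  let l : Ω[S⁄K] →ₗ[S] F := (D.liftKaehlerDifferential.liftBaseChange S).comp e.symm.toLinearMap
  refine ⟨l.compDer (KaehlerDifferential.D K S), fun r => ?_⟩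
  change D.liftKaehlerDifferential.liftBaseChange S
    (e.symm (KaehlerDifferential.D K S (algebraMap R S r))) = D r
  rw [KaehlerDifferential.tensorKaehlerEquivOfFormallyEtale_symm_D_algebraMap,
    LinearMap.liftBaseChange_tmul, one_smul, Derivation.liftKaehlerDifferential_comp_D]

theorem _root_.Derivation.exists_of_surjective {K P R F : Type*} [CommRing K] [CommRing P]
    [CommRing R] [CommRing F] [Algebra K P] [Algebra K R] [Algebra K F] [Algebra P R]
    [Algebra P F] [Algebra R F] [IsScalarTower K P R] [IsScalarTower P R F]
    (hsurj : Function.Surjective (algebraMap P R)) (D : Derivation K P F)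
    (hD : ∀ p, algebraMap P R p = 0 → D p = 0) :
    ∃ D' : Derivation K R F, ∀ p, D' (algebraMap P R p) = D p := by
  let φ := (IsScalarTower.toAlgHom K P R).toLinearMap
  have hker : φ.ker ≤ (D : P →ₗ[K] F).ker := fun p hp => hD p hp
  let l : R →ₗ[K] F := (φ.ker.liftQ (D : P →ₗ[K] F) hker).comp
    (φ.quotKerEquivOfSurjective hsurj).symm.toLinearMap
  have hl (p : P) : l (algebraMap P R p) = D p := by
    have h : (φ.quotKerEquivOfSurjective hsurj).symm (algebraMap P R p) = φ.ker.mkQ p :=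
      (LinearEquiv.symm_apply_eq _).mpr rfl
    change φ.ker.liftQ (D : P →ₗ[K] F) hker
      ((φ.quotKerEquivOfSurjective hsurj).symm (algebraMap P R p)) = _
    rw [h]
    rfl
  refine ⟨Derivation.mk' l fun a b => ?_, hl⟩
  obtain ⟨a, rfl⟩ := hsurj a
  obtain ⟨b, rfl⟩ := hsurj b
  rw [← map_mul, hl, hl, hl, Derivation.leibniz, algebraMap_smul, algebraMap_smul]

theorem dirDeriv_mul {K A σ : Type*} [Field K] [CommRing A] [Algebra K A] [Fintype σ]
    (g h : MvPolynomial σ K) (u v : σ → A) :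
    dirDeriv (g * h) u v = aeval u h * dirDeriv g u v + aeval u g * dirDeriv h u v := by
  simp only [dirDeriv, Finset.mul_sum, ← Finset.sum_add_distrib]
  refine Finset.sum_congr rfl fun i _ => ?_
  simp only [Derivation.leibniz, map_add, smul_eq_mul, map_mul]
  ring

/-- Tangent vectors of the hypersurface `g = 0` at a point give rise to derivations. -/
theorem exists_derivation_of_dirDeriv_eq_zero {K R S F σ : Type*} [Field K] [CommRing R]
    [CommRing S] [CommRing F] [Fintype σ] [Algebra K R] [Algebra K S] [Algebra K F]
    [Algebra (MvPolynomial σ K) R] [Algebra R S] [Algebra R F] [Algebra S F]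
    [IsScalarTower K (MvPolynomial σ K) R] [IsScalarTower K R S] [IsScalarTower K R F]
    [IsScalarTower K S F] [IsScalarTower R S F] [Algebra.FormallyEtale R S]
    (hsurj : Function.Surjective (algebraMap (MvPolynomial σ K) R)) {g : MvPolynomial σ K}
    (hg : ∀ p, algebraMap (MvPolynomial σ K) R p = 0 ↔ g ∣ p) {t : σ → F}
    (ht : dirDeriv g (algebraMap R F ∘ algebraMap (MvPolynomial σ K) R ∘ X) t = 0) :
    ∃ δ : Derivation K S F, δ ∘ (algebraMap R S ∘ algebraMap (MvPolynomial σ K) R ∘ X) = t := by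
  let : Algebra (MvPolynomial σ K) F :=
    ((algebraMap R F).comp (algebraMap (MvPolynomial σ K) R)).toAlgebra
  have : IsScalarTower (MvPolynomial σ K) R F := IsScalarTower.of_algebraMap_eq fun _ => rfl
  have : IsScalarTower K (MvPolynomial σ K) F := IsScalarTower.of_algebraMap_eq fun c => by
    rw [IsScalarTower.algebraMap_apply K R F, IsScalarTower.algebraMap_apply K (MvPolynomial σ K) R]
    rfl
  let D : Derivation K (MvPolynomial σ K) F := mkDerivation K t
  have hDX : D ∘ X = t := by funext i; exact mkDerivation_X K t i
  have hDg : D g = 0 := by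
    have h := derivation_aeval D g X
    rw [aeval_X_left, AlgHom.id_apply, hDX] at h
    rw [h]
    exact ht
  obtain ⟨D', hD'⟩ := D.exists_of_surjective hsurj fun p hp => by
    obtain ⟨q, rfl⟩ := (hg p).mp hp
    have hg0 : algebraMap (MvPolynomial σ K) F g = 0 := by
      rw [IsScalarTower.algebraMap_apply _ R F, (hg g).mpr dvd_rfl, map_zero]
    rw [Derivation.leibniz, hDg, smul_zero, add_zero, Algebra.smul_def, hg0, zero_mul]
  obtain ⟨δ, hδ⟩ := D'.exists_extension_of_formallyEtale (S := S)
  refine ⟨δ, ?_⟩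
  funext i
  rw [Function.comp_apply, Function.comp_apply, hδ, Function.comp_apply, hD', ← hDX,
    Function.comp_apply]

end Derivations

section Specialization

theorem exists_C_mul_mem_of_map_mem {σ R k : Type*} [CommRing R] [IsDomain R] [Field k]
    [Algebra R k] [IsFractionRing R k] {I : Ideal (MvPolynomial σ R)} {x : MvPolynomial σ R}
    (hx : map (algebraMap R k) x ∈ I.map (map (algebraMap R k))) :
    ∃ r : R, r ≠ 0 ∧ C r * x ∈ I := by
  let := algebraMvPolynomial (σ := σ) (R := R) (S := k)
  have := isLocalization (σ := σ) (nonZeroDivisors R) k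
  obtain ⟨_, ⟨r, hr, rfl⟩, h⟩ := (IsLocalization.algebraMap_mem_map_algebraMap_iff
    ((nonZeroDivisors R).map (C (σ := σ))) (MvPolynomial σ k) I x).mp hx
  exact ⟨r, nonZeroDivisors.ne_zero hr, h⟩

/-- A hypersurface `f = 0` with a component `g = 0` is flecnodal at the generic point of `g = 0` if
it is flecnodal at all closed points. -/
theorem exists_flecnodal_direction {K : Type*} [Field K] [IsAlgClosed K] {n : ℕ}
    {f g : MvPolynomial (Fin n) K} (hgf : g ∣ f) [hprime : (Ideal.span {g}).IsPrime]
    {k F : Type*} [Field k] [Field F] [IsAlgClosed F]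
    [Algebra (MvPolynomial (Fin n) K ⧸ Ideal.span {g}) k]
    [IsFractionRing (MvPolynomial (Fin n) K ⧸ Ideal.span {g}) k] [Algebra k F]
    [Algebra K k] [Algebra K F] [IsScalarTower K (MvPolynomial (Fin n) K ⧸ Ideal.span {g}) k]
    [IsScalarTower K k F] {u : Fin n → k}
    (hu : u = fun i => algebraMap (MvPolynomial (Fin n) K ⧸ Ideal.span {g}) k
      (Ideal.Quotient.mk _ (X i))) (hu0 : u ≠ 0)
    (hflec : ∀ u₀ : Fin n → K, u₀ ≠ 0 → MvPolynomial.aeval u₀ f = 0 → ∃ v₀ : Fin n → K,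
      LinearIndependent K ![u₀, v₀] ∧ dirDeriv f u₀ v₀ = 0 ∧ dirDeriv₂ f u₀ v₀ v₀ = 0 ∧
        dirDeriv₃ f u₀ v₀ v₀ v₀ = 0) :
    ∃ v : Fin n → F, (∀ c : F, v ≠ c • (algebraMap k F ∘ u)) ∧
      dirDeriv f (algebraMap k F ∘ u) v = 0 ∧ dirDeriv₂ f (algebraMap k F ∘ u) v v = 0 ∧
        dirDeriv₃ f (algebraMap k F ∘ u) v v v = 0 := by
  set R := MvPolynomial (Fin n) K ⧸ Ideal.span {g} with hR
  by_contra! hcon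
  let uR : Fin n → R := fun i => Ideal.Quotient.mk _ (X i)
  let cR : Fin n → MvPolynomial (Fin n) R := fun i => C (uR i)
  let q : Fin 3 → MvPolynomial (Fin n) R :=
    ![dirDeriv f cR X, dirDeriv₂ f cR X X, dirDeriv₃ f cR X X X]
  let I := Ideal.span (Set.range q)
  let minor (i j : Fin n) : MvPolynomial (Fin n) R := C (uR i) * X j - C (uR j) * X i
  let toF (v : Fin n → F) : MvPolynomial (Fin n) R →ₐ[K] F :=
    ((MvPolynomial.aeval (R := k) v).restrictScalars K).comp
      (mapAlgHom (IsScalarTower.toAlgHom K R k))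
  have toF_apply (v : Fin n → F) (p) :
      toF v p = MvPolynomial.aeval v (map (algebraMap R k) p) := rfl
  have toF_X (v : Fin n → F) : toF v ∘ X = v := by funext i; simp [toF_apply]
  have toF_C (v : Fin n → F) (i : Fin n) : toF v (C (uR i)) = algebraMap k F (u i) := by
    simp [toF_apply, hu, uR]
    rfl
  have toF_c (v : Fin n → F) : toF v ∘ cR = algebraMap k F ∘ u := by
    funext i; exact toF_C v i
  have hminor (i j : Fin n) : ∃ r : R, r ≠ 0 ∧ ∃ N : ℕ, C r * minor i j ^ N ∈ I := by
    have h : map (algebraMap R k) (minor i j) ∈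
        vanishingIdeal k (zeroLocus F (I.map (map (algebraMap R k)))) := by
      rw [mem_vanishingIdeal_iff]
      intro v hv
      have hq (l : Fin 3) : toF v (q l) = 0 :=
        hv _ (Ideal.mem_map_of_mem _ (Ideal.subset_span ⟨l, rfl⟩))
      have h1 := (map_dirDeriv (A := MvPolynomial (Fin n) R) (toF v) f cR X).symm.trans (hq 0)
      have h2 := (map_dirDeriv₂ (A := MvPolynomial (Fin n) R) (toF v) f cR X X).symm.trans (hq 1)
      have h3 := (map_dirDeriv₃ (A := MvPolynomial (Fin n) R) (toF v) f cR X X X).symm.trans (hq 2)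
      rw [toF_c, toF_X] at h1 h2 h3
      by_cases hc : ∃ c : F, v = c • (algebraMap k F ∘ u)
      · obtain ⟨c, hc⟩ := hc
        rw [← toF_apply]
        have hX (l : Fin n) : toF v (X l) = c * algebraMap k F (u l) :=
          (congrFun (toF_X v) l).trans (congrFun hc l)
        simp only [minor, map_sub, map_mul, toF_C, hX]
        ring
      · exact absurd h3 (hcon v (not_exists.mp hc) h1 h2)
    rw [vanishingIdeal_zeroLocus_eq_radical] at h
    obtain ⟨N, hN⟩ := h
    rw [← map_pow] at hN
    obtain ⟨r, hr, h⟩ := exists_C_mul_mem_of_map_mem hN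
    exact ⟨r, hr, N, h⟩
  choose r hr N hN using hminor
  obtain ⟨l, hl⟩ : ∃ l, uR l ≠ 0 := by
    by_contra! h
    refine hu0 (_root_.funext fun i => ?_)
    rw [hu]
    exact (congrArg _ (h i)).trans (map_zero _)
  obtain ⟨p, hp⟩ := Ideal.Quotient.mk_surjective (uR l * ∏ i, ∏ j, r i j)
  have hp' : p ∉ vanishingIdeal K (zeroLocus K (Ideal.span {g})) := by
    rw [IsPrime.vanishingIdeal_zeroLocus, ← Ideal.Quotient.eq_zero_iff_mem, hp]
    exact mul_ne_zero hl (Finset.prod_ne_zero_iff.mpr fun i _ =>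
      Finset.prod_ne_zero_iff.mpr fun j _ => hr i j)
  rw [mem_vanishingIdeal_iff] at hp'
  push Not at hp'
  obtain ⟨u₀, hu₀, hpu₀⟩ := hp'
  let ρ : R →ₐ[K] K := Ideal.Quotient.liftₐ _ (MvPolynomial.aeval u₀) hu₀
  have hρ (p) : ρ (Ideal.Quotient.mk _ p) = MvPolynomial.aeval u₀ p := rfl
  have hρu (i : Fin n) : ρ (uR i) = u₀ i := (hρ _).trans (aeval_X u₀ i)
  rw [← hρ, hp, map_mul, hρu] at hpu₀
  have hu₀l := left_ne_zero_of_mul hpu₀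
  have hρr (i j) : ρ (r i j) ≠ 0 := by
    have h := right_ne_zero_of_mul hpu₀
    rw [map_prod, Finset.prod_ne_zero_iff] at h
    have h' := h i (Finset.mem_univ i)
    rw [map_prod, Finset.prod_ne_zero_iff] at h'
    exact h' j (Finset.mem_univ j)
  obtain ⟨v₀, hli, h1, h2, h3⟩ := hflec u₀ (fun h => hu₀l (congrFun h l))
    (zeroLocus_anti_mono (Ideal.span_singleton_le_span_singleton.mpr hgf) hu₀ f
      (Ideal.mem_span_singleton_self f))
  let τ : MvPolynomial (Fin n) R →ₐ[K] K := aevalTower ρ v₀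
  have τX : τ ∘ X = v₀ := by funext i; simp [τ]
  have τc : τ ∘ cR = u₀ := by funext i; simp [τ, cR, hρu]
  have hτI : I ≤ RingHom.ker τ := by
    rw [Ideal.span_le]
    rintro _ ⟨i, rfl⟩
    rw [SetLike.mem_coe, RingHom.mem_ker]
    fin_cases i
    · exact (map_dirDeriv (A := MvPolynomial (Fin n) R) τ f cR X).trans (by rw [τX, τc, h1])
    · exact (map_dirDeriv₂ (A := MvPolynomial (Fin n) R) τ f cR X X).trans (by rw [τX, τc, h2])
    · exact (map_dirDeriv₃ (A := MvPolynomial (Fin n) R) τ f cR X X X).trans (by rw [τX, τc, h3])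
  have hmin (i j : Fin n) : u₀ i * v₀ j - u₀ j * v₀ i = 0 := by
    have h := hτI (hN i j)
    rw [RingHom.mem_ker, map_mul, map_pow] at h
    simp only [τ, minor, aevalTower_C, aevalTower_X, map_sub, map_mul, hρu] at h
    exact eq_zero_of_pow_eq_zero ((mul_eq_zero.mp h).resolve_left (hρr i j))
  refine hu₀l (neg_eq_zero.mp ((LinearIndependent.pair_iff.mp hli (v₀ l) (-u₀ l) ?_).2))
  funext i
  simp only [Pi.add_apply, Pi.smul_apply, smul_eq_mul, Pi.zero_apply]
  linear_combination hmin i l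

end Specialization

theorem exists_not_dvd_X {K : Type*} [Field K] {σ : Type*} [Nontrivial σ] {g : MvPolynomial σ K}
    (hg : Prime g) : ∃ l, ¬ g ∣ X l := by
  by_contra! hX
  obtain ⟨a, b, hab⟩ := exists_pair_ne σ
  have h := ((X_prime (R := K) (i := a)).irreducible.dvd_iff.mp (hX a)).resolve_left hg.not_isUnit
  exact hab (X_dvd_X.mp (h.dvd.trans (hX b)))

section Smooth

variable {K : Type*} [Field K] [IsAlgClosed K] {σ : Type*} [Finite σ] {f : MvPolynomial σ K}

theorem exists_X_pow_mem_span_pderiv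
    (hf : ∀ w : σ → K, w ≠ 0 → ∃ i, eval w (pderiv i f) ≠ 0) (l : σ) :
    ∃ N, (X l : MvPolynomial σ K) ^ N ∈ Ideal.span (Set.range fun i => pderiv i f) := by
  have h : X l ∈ vanishingIdeal K (zeroLocus K (Ideal.span (Set.range fun i => pderiv i f))) := by
    rw [mem_vanishingIdeal_iff]
    intro w hw
    have hw0 : w = 0 := by
      by_contra hne
      obtain ⟨i, hi⟩ := hf w hne
      exact hi (hw _ (Ideal.subset_span ⟨i, rfl⟩))
    simp [hw0]
  rwa [vanishingIdeal_zeroLocus_eq_radical] at h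

theorem eq_zero_of_aeval_pderiv_eq_zero {A : Type*} [CommRing A] [IsDomain A] [Algebra K A]
    (hf : ∀ w : σ → K, w ≠ 0 → ∃ i, eval w (pderiv i f) ≠ 0) {x : σ → A}
    (hx : ∀ i, aeval x (pderiv i f) = 0) : x = 0 := by
  funext l
  obtain ⟨N, hN⟩ := exists_X_pow_mem_span_pderiv hf l
  have hle : Ideal.span (Set.range fun i => pderiv i f) ≤ RingHom.ker (aeval (R := K) x) := by
    rw [Ideal.span_le]
    rintro _ ⟨i, rfl⟩
    exact hx i
  have h := hle hN
  rw [RingHom.mem_ker, map_pow, aeval_X] at h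
  exact eq_zero_of_pow_eq_zero h

theorem exists_not_dvd_pderiv_of_prime [Nontrivial σ]
    (hf : ∀ w : σ → K, w ≠ 0 → ∃ i, eval w (pderiv i f) ≠ 0) {g : MvPolynomial σ K}
    (hg : Prime g) : ∃ i, ¬ g ∣ pderiv i f := by
  by_contra! h
  obtain ⟨l, hl⟩ := exists_not_dvd_X hg
  obtain ⟨N, hN⟩ := exists_X_pow_mem_span_pderiv hf l
  refine hl (hg.dvd_of_dvd_pow (Ideal.mem_span_singleton.mp (Ideal.span_le.mpr ?_ hN)))
  rintro _ ⟨i, rfl⟩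
  exact Ideal.mem_span_singleton.mpr (h i)

end Smooth

theorem exists_prime_dvd_of_smooth {K : Type*} [Field K] [IsAlgClosed K] {σ : Type*} [Nonempty σ]
    {f : MvPolynomial σ K}
    (hf : ∀ w : σ → K, w ≠ 0 → ∃ i, eval w (pderiv i f) ≠ 0) : ∃ g, Prime g ∧ g ∣ f := by
  have hne (c : K) : f ≠ C c := by
    rintro rfl
    obtain ⟨i, hi⟩ := hf 1 one_ne_zero
    simp at hi
  have hu : ¬ IsUnit f := by
    intro h
    obtain ⟨c, -, hc⟩ := isUnit_iff_eq_C_of_isReduced.mp h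
    exact hne c hc
  obtain ⟨g, hg, hgf⟩ := WfDvdMonoid.exists_irreducible_factor hu (by simpa using hne 0)
  exact ⟨g, hg.prime, hgf⟩

theorem dirDeriv_eq_zero_of_ordGE {K : Type*} [Field K] {n : ℕ} {f : MvPolynomial (Fin n) K}
    {u v : Fin n → K} (h : ordGE f u v 4) :
    dirDeriv f u v = 0 ∧ dirDeriv₂ f u v v = 0 ∧ dirDeriv₃ f u v v v = 0 := by
  have h' (j : ℕ) (hj : j < 4) : (lineRestriction f u v).coeff j = 0 := h j hj
  exact ⟨by rw [dirDeriv_eq_coeff, h' 1 (by norm_num)],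
    by rw [dirDeriv₂_eq_coeff, h' 2 (by norm_num), mul_zero],
    by rw [dirDeriv₃_eq_coeff, h' 3 (by norm_num), mul_zero]⟩

/-- The closed points of a smooth surface `f = 0` are not all flecnodal. -/
theorem false_of_forall_flecnodal {K : Type*} [Field K] [IsAlgClosed K] {d : ℕ} (hd : 3 ≤ d)
    (hchar : ∀ n : ℕ, n + 1 ≤ d → ((n + 1 : ℕ) : K) ≠ 0)
    {f g : MvPolynomial (Fin 4) K} (hf : IsSmoothSurfaceOfDegree f d) (hg : Prime g) (hgf : g ∣ f)
    [hprime : (Ideal.span {g}).IsPrime] (k F : Type*) [Field k] [Field F] [IsAlgClosed F]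
    [Algebra (MvPolynomial (Fin 4) K ⧸ Ideal.span {g}) k]
    [IsFractionRing (MvPolynomial (Fin 4) K ⧸ Ideal.span {g}) k] [Algebra k F]
    [Algebra (MvPolynomial (Fin 4) K ⧸ Ideal.span {g}) F]
    [IsScalarTower (MvPolynomial (Fin 4) K ⧸ Ideal.span {g}) k F]
    [Algebra K k] [Algebra K F] [IsScalarTower K (MvPolynomial (Fin 4) K ⧸ Ideal.span {g}) k]
    [IsScalarTower K k F]
    (hflec : ∀ u₀ : Fin 4 → K, u₀ ≠ 0 → aeval u₀ f = 0 → ∃ v₀ : Fin 4 → K,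
      LinearIndependent K ![u₀, v₀] ∧ dirDeriv f u₀ v₀ = 0 ∧ dirDeriv₂ f u₀ v₀ v₀ = 0 ∧
        dirDeriv₃ f u₀ v₀ v₀ v₀ = 0) : False := by
  obtain ⟨hhom, hsm⟩ := hf
  obtain ⟨h, rfl⟩ := hgf
  let R := MvPolynomial (Fin 4) K ⧸ Ideal.span {g}
  let S := separableClosure k F
  have : IsScalarTower K S F := .of_algebraMap_eq fun _ => rfl
  have : IsScalarTower R S F := .of_algebraMap_eq fun _ => rfl
  have : IsScalarTower K R F := .to₁₂₄ K R k F
  have : IsScalarTower K R S := .to₁₂₄ K R k S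
  let u : Fin 4 → k := fun i =>
    algebraMap (MvPolynomial (Fin 4) K ⧸ Ideal.span {g}) k (Ideal.Quotient.mk _ (X i))
  have hu_eval (p : MvPolynomial (Fin 4) K) :
      aeval u p =
        algebraMap (MvPolynomial (Fin 4) K ⧸ Ideal.span {g}) k (Ideal.Quotient.mk _ p) := by
    have : aeval u =
        (IsScalarTower.toAlgHom K R k).comp (Ideal.Quotient.mkₐ K (Ideal.span {g})) := by
      ext i; simp [u, R]
    rw [this]; rfl
  have hu_zero (p : MvPolynomial (Fin 4) K) : aeval u p = 0 ↔ g ∣ p := by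
    rw [hu_eval, FaithfulSMul.algebraMap_eq_zero_iff, Ideal.Quotient.eq_zero_iff_mem,
      Ideal.mem_span_singleton]
  have hUF (p : MvPolynomial (Fin 4) K) :
      aeval (algebraMap k F ∘ u) p = algebraMap k F (aeval u p) := aeval_algebraMap_apply F u p
  have hreg : ∃ i, aeval u (pderiv i (g * h)) ≠ 0 := by
    obtain ⟨i, hi⟩ := exists_not_dvd_pderiv_of_prime hsm hg
    exact ⟨i, mt (hu_zero _).mp hi⟩
  have hu0 : u ≠ 0 := by
    intro h0
    obtain ⟨l, hl⟩ := exists_not_dvd_X hg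
    exact hl ((hu_zero _).mp (by rw [aeval_X, h0, Pi.zero_apply]))
  have hder (t : Fin 4 → F) (ht : dirDeriv (g * h) (algebraMap k F ∘ u) t = 0) :
      ∃ δ : Derivation K S F, δ ∘ (algebraMap k S ∘ u) = t := by
    have hh : aeval u h ≠ 0 := by
      intro h0
      have hdvd := (hu_zero h).mp h0
      obtain ⟨i, hi⟩ := hreg
      refine hi ((hu_zero _).mpr ?_)
      rw [Derivation.leibniz]
      exact dvd_add (dvd_mul_right _ _) (Dvd.dvd.mul_right hdvd _)
    rw [dirDeriv_mul, hUF, hUF, (hu_zero g).mpr dvd_rfl, map_zero, zero_mul, add_zero] at ht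
    have ht' := (mul_eq_zero.mp ht).resolve_left
      (mt (FaithfulSMul.algebraMap_eq_zero_iff k F).mp hh)
    have : Algebra.FormallyEtale R k := .of_isLocalization (nonZeroDivisors R)
    have : Algebra.FormallyEtale k S := .of_isSeparable k S
    have : Algebra.FormallyEtale R S := .comp R k S
    have hF : algebraMap k F ∘ u = algebraMap R F ∘ algebraMap (MvPolynomial (Fin 4) K) R ∘ X :=
      _root_.funext fun i => (IsScalarTower.algebraMap_apply R k F _).symm
    have hS : algebraMap k S ∘ u = algebraMap R S ∘ algebraMap (MvPolynomial (Fin 4) K) R ∘ X :=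
      _root_.funext fun i => (IsScalarTower.algebraMap_apply R k S _).symm
    have hker (p : MvPolynomial (Fin 4) K) : algebraMap (MvPolynomial (Fin 4) K) R p = 0 ↔ g ∣ p :=
      Ideal.Quotient.eq_zero_iff_mem.trans Ideal.mem_span_singleton
    rw [hF] at ht'
    rw [hS]
    exact exists_derivation_of_dirDeriv_eq_zero (R := R) Ideal.Quotient.mk_surjective hker ht'
  obtain ⟨v, hv, h1, h2, h3⟩ := exists_flecnodal_direction (Dvd.intro h rfl) (k := k) (F := F)
    (u := u) rfl hu0 hflec
  obtain ⟨c, hc⟩ := hhom.exists_eq_smul_of_flecnodal_direction (S := S) hd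
    (fun n hn => by
      rw [← map_natCast (algebraMap K F)]
      exact mt (FaithfulSMul.algebraMap_eq_zero_iff K F).mp (hchar n hn))
    (fun x hx => eq_zero_of_aeval_pderiv_eq_zero hsm hx) hu0
    ((hu_zero _).mpr (Dvd.intro h rfl)) hreg hder
    (fun x hx => ⟨⟨x, mem_separableClosure_iff.mpr hx⟩, rfl⟩) h1 h2 h3
  exact hv c hc

end MvPolynomial

theorem exists_nonflecnodal_point
    {K : Type*} [Field K] [IsAlgClosed K] (d : ℕ) (hd : 3 ≤ d)
    (hchar : ringChar K = 0 ∨ d < ringChar K)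
    (f : MvPolynomial (Fin 4) K) (hf : IsSmoothSurfaceOfDegree f d) :
    ∃ u : Fin 4 → K, u ≠ 0 ∧ MvPolynomial.eval u f = 0 ∧
      ∀ v : Fin 4 → K, LinearIndependent K ![u, v] → ¬ ordGE f u v 4 := by
  by_contra! hcon
  obtain ⟨g, hg, hgf⟩ := exists_prime_dvd_of_smooth hf.2
  have hprime : (Ideal.span {g}).IsPrime := (Ideal.span_singleton_prime hg.ne_zero).mpr hg
  refine false_of_forall_flecnodal hd (fun n hn h0 => ?_) hf hg hgf
    (FractionRing (MvPolynomial (Fin 4) K ⧸ Ideal.span {g}))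
    (AlgebraicClosure (FractionRing (MvPolynomial (Fin 4) K ⧸ Ideal.span {g})))
    fun u₀ hu₀ h0 => ?_
  · have hdvd := (ringChar.spec K (n + 1)).mp h0
    rcases hchar with h | h
    · rw [h] at hdvd
      exact absurd (zero_dvd_iff.mp hdvd) (Nat.succ_ne_zero n)
    · exact absurd (Nat.le_of_dvd n.succ_pos hdvd) (by omega)
  · obtain ⟨v, hv, hord⟩ := hcon u₀ hu₀ h0
    exact ⟨v, hv, dirDeriv_eq_zero_of_ordGE hord⟩
end
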